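/- Let M be an Alexandrov space and E an extremal subset of M. Then for all sufficiently small δ > 0, the Hausdorff dimension of E equals the δ-strainer number of E, i.e., the supremum of integers k such that E contains a (k,δ)-strained point of M. In particular, the Hausdorff dimension of an extremal subset is an integer. -/

import Mathlib

open Real Metric Set
open scoped ENNReal NNReal

noncomputable section

/-- The comparison angle in the `κ`-plane at the vertex between sides of
lengths `s` and `t`, opposite side of length `d`. -/
def cangleK (κ s t d : ℝ) : ℝ :=
  if 0 < κ then
    Real.arccos ((Real.cos (Real.sqrt κ * d) - Real.cos (Real.sqrt κ * s) * Real.cos (Real.sqrt κ * t)) /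
      (Real.sin (Real.sqrt κ * s) * Real.sin (Real.sqrt κ * t)))
  else if κ < 0 then
    Real.arccos ((Real.cosh (Real.sqrt (-κ) * s) * Real.cosh (Real.sqrt (-κ) * t) -
      Real.cosh (Real.sqrt (-κ) * d)) /
      (Real.sinh (Real.sqrt (-κ) * s) * Real.sinh (Real.sqrt (-κ) * t)))
  else Real.arccos ((s ^ 2 + t ^ 2 - d ^ 2) / (2 * s * t))

/-- The comparison angle `∠̃ q p r` at `p` in the `κ`-plane. -/
def cangle {X : Type*} [MetricSpace X] (κ : ℝ) (q p r : X) : ℝ :=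
  cangleK κ (dist p q) (dist p r) (dist q r)

/-- A `(k,δ)`-strainer at `p` (comparison angles taken in the `κ`-plane). -/
def IsStrainer {X : Type*} [MetricSpace X] (κ : ℝ) {k : ℕ} (a b : Fin k → X) (p : X)
    (δ : ℝ) : Prop :=
  (∀ i, π - δ < cangle κ (a i) p (b i)) ∧
  ∀ i j, i ≠ j →
    π / 2 - δ < cangle κ (a i) p (a j) ∧
    π / 2 - δ < cangle κ (a i) p (b j) ∧
    π / 2 - δ < cangle κ (b i) p (b j)

/-- A `(k,δ)`-strained point. -/
def IsStrainedPt {X : Type*} [MetricSpace X] (κ : ℝ) (k : ℕ) (δ : ℝ) (p : X) : Prop :=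
  ∃ a b : Fin k → X, IsStrainer κ a b p δ

/-- An Alexandrov space of curvature `≥ κ`: complete, geodesic (via midpoints), and the
sum of the three `κ`-comparison angles of any quadruple is at most `2π`. -/
def IsAlexandrov (X : Type*) [MetricSpace X] (κ : ℝ) : Prop :=
  CompleteSpace X ∧
  (∀ x y : X, ∃ z : X, dist x z = dist x y / 2 ∧ dist z y = dist x y / 2) ∧
  ∀ p q r s : X, q ≠ p → r ≠ p → s ≠ p →
    cangle κ q p r + cangle κ r p s + cangle κ s p q ≤ 2 * π

/-- `p` is a critical point of `dist q`. -/
def IsCriticalPt {X : Type*} [MetricSpace X] (κ : ℝ) (q p : X) : Prop :=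
  ∀ x : X, x ≠ p → cangle κ q p x ≤ π / 2

/-- An extremal subset: closed, and every local minimum point `p ∈ E` of `dist q|_E`
with `q ∉ E` is a critical point of `dist q`. -/
def IsExtremal {X : Type*} [MetricSpace X] (κ : ℝ) (E : Set X) : Prop :=
  IsClosed E ∧
  ∀ q ∉ E, ∀ p ∈ E, IsLocalMinOn (fun x => dist q x) E p → IsCriticalPt κ q p

/-- A primitive extremal subset: an extremal subset containing no proper extremal
subset with nonempty relative interior. -/
def IsPrimitiveExtremal {X : Type*} [MetricSpace X] (κ : ℝ) (E : Set X) : Prop :=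
  IsExtremal κ E ∧
  ∀ F : Set X, IsExtremal κ F → F ⊆ E → F ≠ E →
    ∀ x ∈ F, ¬ ∃ r > (0:ℝ), Metric.ball x r ∩ E ⊆ F

/-- `p` is a regular point of `E` of dimension `m`: the tangent cone of `E` at `p`
(with the extrinsic metric) is isometric to `ℝ^m`, expressed through blow-ups:
balls of `E` around `p` at scale `r` are `εr`-approximated by `r`-balls of `ℝ^m`. -/
def IsRegularPt {X : Type*} [MetricSpace X] (E : Set X) (m : ℕ) (p : X) : Prop :=
  ∀ ε > (0:ℝ), ∃ r₀ > (0:ℝ), ∀ r, 0 < r → r < r₀ →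
    ∃ f : X → EuclideanSpace ℝ (Fin m),
      f p = 0 ∧
      (∀ x ∈ E ∩ Metric.closedBall p r, ∀ y ∈ E ∩ Metric.closedBall p r,
        |dist (f x) (f y) - dist x y| ≤ ε * r) ∧
      (∀ v ∈ Metric.closedBall (0 : EuclideanSpace ℝ (Fin m)) r,
        ∃ x ∈ E ∩ Metric.closedBall p r, dist (f x) v ≤ ε * r)

/-- The intrinsic (induced length) extended distance on a subset `E`. -/
def intrinsicEDist {X : Type*} [MetricSpace X] (E : Set X) (x y : X) : ℝ≥0∞ :=
  ⨅ (γ : ℝ → X) (_ : ContinuousOn γ (Set.Icc 0 1)) (_ : γ 0 = x) (_ : γ 1 = y)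
    (_ : ∀ t ∈ Set.Icc (0:ℝ) 1, γ t ∈ E), eVariationOn γ (Set.Icc 0 1)

/-- Diameter of a set with respect to an abstract extended distance. -/
def ediamOn {X : Type*} (ρ : X → X → ℝ≥0∞) (s : Set X) : ℝ≥0∞ :=
  ⨆ x ∈ s, ⨆ y ∈ s, ρ x y

/-- The `m`-dimensional Hausdorff measure of `S` with respect to an abstract
extended distance `ρ`. -/
def hMeas {X : Type*} (ρ : X → X → ℝ≥0∞) (m : ℝ) (S : Set X) : ℝ≥0∞ :=
  ⨆ (ε : ℝ≥0∞) (_ : 0 < ε),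
    ⨅ (t : ℕ → Set X) (_ : S ⊆ ⋃ n, t n) (_ : ∀ n, ediamOn ρ (t n) ≤ ε),
      ∑' n, ediamOn ρ (t n) ^ m

end

section Auxiliary

open Filter Topology

/-- The generalized sine of the `κ`-plane. -/
noncomputable def snK (κ x : ℝ) : ℝ :=
  if 0 < κ then Real.sin (Real.sqrt κ * x) / Real.sqrt κ
  else if κ < 0 then Real.sinh (Real.sqrt (-κ) * x) / Real.sqrt (-κ)
  else x

lemma snK_zero (κ : ℝ) : snK κ 0 = 0 := by
  unfold snK; split_ifs <;> simp

lemma hasDerivAt_snK_zero (κ : ℝ) : HasDerivAt (snK κ) 1 0 := by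
  have scale (g : ℝ → ℝ) (hg : HasDerivAt g 1 0) (c : ℝ) (hc : c ≠ 0) :
      HasDerivAt (fun x => g (c * x) / c) 1 0 := by
    have h1 : HasDerivAt (fun x : ℝ => c * x) c 0 := by
      simpa using (hasDerivAt_id (0 : ℝ)).const_mul c
    have h2 : HasDerivAt g 1 (c * 0) := by simpa using hg
    simpa [hc] using (h2.comp (0 : ℝ) h1).div_const c
  rcases lt_trichotomy κ 0 with h | h | h
  · have : snK κ = fun x => Real.sinh (Real.sqrt (-κ) * x) / Real.sqrt (-κ) := by
      funext x; simp [snK, h, h.le.not_gt]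
    rw [this]
    exact scale _ (by simpa using Real.hasDerivAt_sinh 0) _ (Real.sqrt_pos.2 (by linarith)).ne'
  · have : snK κ = fun x => x := by
      funext x; simp [snK, h]
    rw [this]
    exact hasDerivAt_id 0
  · have : snK κ = fun x => Real.sin (Real.sqrt κ * x) / Real.sqrt κ := by
      funext x; simp [snK, h]
    rw [this]
    exact scale _ (by simpa using Real.hasDerivAt_sin 0) _ (Real.sqrt_pos.2 h).ne'

lemma continuous_snK (κ : ℝ) : Continuous (snK κ) := by
  rcases lt_trichotomy κ 0 with h | h | h
  · have : snK κ = fun x => Real.sinh (Real.sqrt (-κ) * x) / Real.sqrt (-κ) := by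
      funext x; simp [snK, h, h.le.not_gt]
    rw [this]; fun_prop
  · have : snK κ = fun x => x := by
      funext x; simp [snK, h]
    rw [this]; fun_prop
  · have : snK κ = fun x => Real.sin (Real.sqrt κ * x) / Real.sqrt κ := by
      funext x; simp [snK, h]
    rw [this]; fun_prop

lemma cangleK_of_snK_eq_zero {κ s t : ℝ} (d : ℝ) (h : snK κ s = 0 ∨ snK κ t = 0) :
    cangleK κ s t d = π / 2 := by
  unfold snK at h
  unfold cangleK
  split_ifs at h ⊢ with h1 h2
  · have : Real.sqrt κ ≠ 0 := (Real.sqrt_pos.2 h1).ne'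
    have : Real.sin (Real.sqrt κ * s) * Real.sin (Real.sqrt κ * t) = 0 := by
      simpa [this] using h
    simp [this]
  · have : Real.sqrt (-κ) ≠ 0 := (Real.sqrt_pos.2 (by linarith)).ne'
    have : Real.sinh (Real.sqrt (-κ) * s) * Real.sinh (Real.sqrt (-κ) * t) = 0 := by
      rcases h with h | h
      · rw [div_eq_zero_iff, or_iff_left this] at h
        rw [h, zero_mul]
      · rw [div_eq_zero_iff, or_iff_left this] at h
        rw [h, mul_zero]
    simp [this]
  · rcases h with h | h <;> simp [h]

lemma cangleK_eq {κ s t : ℝ} (d : ℝ) (hs : snK κ s ≠ 0) (ht : snK κ t ≠ 0) :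
    cangleK κ s t d = Real.arccos
      (1 - 2 * (snK κ ((d + s - t) / 2) * snK κ ((d - s + t) / 2)) / (snK κ s * snK κ t)) := by
  unfold snK at hs ht ⊢
  unfold cangleK
  split_ifs at hs ht ⊢ with h1 h2
  · have h0 : Real.sqrt κ ≠ 0 := (Real.sqrt_pos.2 h1).ne'
    set c := Real.sqrt κ
    have hs' : Real.sin (c * s) ≠ 0 := fun h => hs (by simp [h])
    have ht' : Real.sin (c * t) ≠ 0 := fun h => ht (by simp [h])
    have e : Real.cos (c * d) = Real.cos (c * s) * Real.cos (c * t)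
        + Real.sin (c * s) * Real.sin (c * t)
        - 2 * Real.sin (c * ((d + s - t) / 2)) * Real.sin (c * ((d - s + t) / 2)) := by
      have := Real.cos_sub_cos (c * d) (c * s - c * t)
      rw [Real.cos_sub, show (c * d + (c * s - c * t)) / 2 = c * ((d + s - t) / 2) by ring,
        show (c * d - (c * s - c * t)) / 2 = c * ((d - s + t) / 2) by ring] at this
      linarith
    rw [e]
    congr 1
    field_simp
    ring
  · have h0 : Real.sqrt (-κ) ≠ 0 := (Real.sqrt_pos.2 (by linarith)).ne'
    set c := Real.sqrt (-κ)
    have hs' : Real.sinh (c * s) ≠ 0 := fun h => hs (by simp [h])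
    have ht' : Real.sinh (c * t) ≠ 0 := fun h => ht (by simp [h])
    have e : Real.cosh (c * d) = Real.cosh (c * s) * Real.cosh (c * t)
        - Real.sinh (c * s) * Real.sinh (c * t)
        + 2 * Real.sinh (c * ((d + s - t) / 2)) * Real.sinh (c * ((d - s + t) / 2)) := by
      have a1 := Real.cosh_add (c * ((d + s - t) / 2)) (c * ((d - s + t) / 2))
      have a2 := Real.cosh_sub (c * ((d + s - t) / 2)) (c * ((d - s + t) / 2))
      rw [show c * ((d + s - t) / 2) + c * ((d - s + t) / 2) = c * d by ring] at a1
      rw [show c * ((d + s - t) / 2) - c * ((d - s + t) / 2) = c * s - c * t by ring,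
        Real.cosh_sub] at a2
      linarith
    rw [e]
    congr 1
    field_simp
    ring
  · congr 1
    field_simp
    ring

lemma cangleK_comm (κ s t d : ℝ) : cangleK κ s t d = cangleK κ t s d := by
  unfold cangleK
  split_ifs
  · rw [mul_comm (Real.cos _), mul_comm (Real.sin _)]
  · rw [mul_comm (Real.cosh (_ * s)), mul_comm (Real.sinh _)]
  · congr 1; ring

lemma cangle_comm {X : Type*} [MetricSpace X] (κ : ℝ) (q p r : X) :
    cangle κ q p r = cangle κ r p q := by
  unfold cangle
  rw [cangleK_comm, dist_comm q r]

lemma cangleK_mem (κ s t d : ℝ) : 0 ≤ cangleK κ s t d ∧ cangleK κ s t d ≤ π := by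
  unfold cangleK
  split_ifs <;> exact ⟨Real.arccos_nonneg _, Real.arccos_le_pi _⟩

lemma abs_cos_arccos_sub_le {x y : ℝ} (h1 : -1 ≤ y) (h2 : y ≤ 1) :
    |Real.cos (Real.arccos x) - y| ≤ |x - y| := by
  rcases le_total x (-1) with hx | hx
  · rw [Real.arccos_of_le_neg_one hx, Real.cos_pi, abs_of_nonpos (by linarith),
      abs_of_nonpos (by linarith)]
    linarith
  rcases le_total x 1 with hx' | hx'
  · rw [Real.cos_arccos hx hx']
  · rw [Real.arccos_of_one_le hx', Real.cos_zero, abs_of_nonneg (by linarith),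
      abs_of_nonneg (by linarith)]
    linarith

/-- `snK κ x = x * φ x` with `φ` continuous at `0` and `φ 0 = 1`. -/
lemma exists_snK_eq_mul (κ : ℝ) :
    ∃ φ : ℝ → ℝ, (∀ x, snK κ x = x * φ x) ∧ Tendsto φ (𝓝 0) (𝓝 1) := by
  refine ⟨dslope (snK κ) 0, fun x => ?_, ?_⟩
  · have := sub_smul_dslope (snK κ) 0 x
    simpa [snK_zero] using this.symm
  · have h := (continuousAt_dslope_same (𝕜 := ℝ) (f := snK κ) (a := 0)).2
      (hasDerivAt_snK_zero κ).differentiableAt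
    have h' := h.tendsto
    rwa [dslope_same, (hasDerivAt_snK_zero κ).deriv] at h'

/-- In small triangles the `κ`-comparison angle is close to the Euclidean one. -/
lemma cos_cangleK_approx (κ : ℝ) {η : ℝ} (hη : 0 < η) : ∃ R > 0, ∀ s t d : ℝ, 0 < s → 0 < t →
    s < R → t < R → |s - t| ≤ d → d ≤ s + t → snK κ s ≠ 0 ∧ snK κ t ≠ 0 ∧
    |Real.cos (cangleK κ s t d) - (s ^ 2 + t ^ 2 - d ^ 2) / (2 * s * t)| ≤ η := by
  obtain ⟨φ, hφ, hlim⟩ := exists_snK_eq_mul κ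
  have hF : Tendsto (fun z : (ℝ × ℝ) × (ℝ × ℝ) => φ z.1.1 * φ z.1.2 / (φ z.2.1 * φ z.2.2))
      ((𝓝 0 ×ˢ 𝓝 0) ×ˢ (𝓝 0 ×ˢ 𝓝 0)) (𝓝 1) := by
    have a := hlim.comp (tendsto_fst (f := 𝓝 (0 : ℝ)) (g := 𝓝 (0 : ℝ)))
    have b := hlim.comp (tendsto_snd (f := 𝓝 (0 : ℝ)) (g := 𝓝 (0 : ℝ)))
    have c := (a.mul b).comp (tendsto_fst (g := 𝓝 (0 : ℝ) ×ˢ 𝓝 (0 : ℝ)))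
    have d := (a.mul b).comp (tendsto_snd (f := 𝓝 (0 : ℝ) ×ˢ 𝓝 (0 : ℝ)))
    have e := c.div d (by norm_num)
    rw [mul_one, div_one] at e
    exact e
  have hF' : ∀ᶠ z : (ℝ × ℝ) × (ℝ × ℝ) in 𝓝 0,
      |φ z.1.1 * φ z.1.2 / (φ z.2.1 * φ z.2.2) - 1| < η / 2 := by
    have : (𝓝 (0 : (ℝ × ℝ) × (ℝ × ℝ))) = ((𝓝 0 ×ˢ 𝓝 0) ×ˢ (𝓝 0 ×ˢ 𝓝 0)) := by
      rw [← nhds_prod_eq, ← nhds_prod_eq]; rfl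
    rw [this]
    have := (Metric.tendsto_nhds.1 hF) (η / 2) (by positivity)
    simpa [Real.dist_eq] using this
  obtain ⟨R1, hR1, H1⟩ := Metric.eventually_nhds_iff.1 hF'
  have hφ' : ∀ᶠ x in 𝓝 0, 0 < φ x := hlim.eventually (lt_mem_nhds zero_lt_one)
  obtain ⟨R2, hR2, H2⟩ := Metric.eventually_nhds_iff.1 hφ'
  refine ⟨min (R1 / 2) R2, by positivity, fun s t d hs ht hsR htR hd1 hd2 => ?_⟩
  have hsR1 := hsR.trans_le (min_le_left _ _)
  have htR1 := htR.trans_le (min_le_left _ _)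
  obtain ⟨hd3, hd4⟩ := abs_le.1 hd1
  have ps : 0 < φ s := H2 (by
    rw [Real.dist_0_eq_abs, abs_of_pos hs]; exact hsR.trans_le (min_le_right _ _))
  have pt : 0 < φ t := H2 (by
    rw [Real.dist_0_eq_abs, abs_of_pos ht]; exact htR.trans_le (min_le_right _ _))
  have ns : snK κ s ≠ 0 := by rw [hφ]; positivity
  have nt : snK κ t ≠ 0 := by rw [hφ]; positivity
  refine ⟨ns, nt, ?_⟩
  set u := (d + s - t) / 2 with hu
  set v := (d - s + t) / 2 with hv
  have hu0 : 0 ≤ u := by rw [hu]; linarith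
  have hv0 : 0 ≤ v := by rw [hv]; linarith
  have hus : u ≤ s := by rw [hu]; linarith
  have hvt : v ≤ t := by rw [hv]; linarith
  have key := @H1 ((u, v), (s, t)) (by
    rw [Prod.dist_eq, Prod.dist_eq, Prod.dist_eq]
    simp only [Prod.fst_zero, Prod.snd_zero, Real.dist_0_eq_abs, max_lt_iff]
    refine ⟨⟨?_, ?_⟩, ?_, ?_⟩ <;> rw [abs_lt] <;> constructor <;> linarith)
  simp only at key
  have e1 : (s ^ 2 + t ^ 2 - d ^ 2) / (2 * s * t) = 1 - 2 * (u * v) / (s * t) := by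
    rw [hu, hv]; field_simp; ring
  have q0 : 0 ≤ u * v / (s * t) := by positivity
  have q1 : u * v / (s * t) ≤ 1 := by
    rw [div_le_one (by positivity)]
    exact mul_le_mul hus hvt hv0 hs.le
  have e2 : 2 * (u * v) / (s * t) = 2 * (u * v / (s * t)) := by ring
  rw [cangleK_eq d ns nt, e1, ← hu, ← hv]
  refine (abs_cos_arccos_sub_le (by rw [e2]; linarith) (by rw [e2]; linarith)).trans ?_
  rw [hφ u, hφ v, hφ s, hφ t]
  have e3 : 1 - 2 * (u * φ u * (v * φ v)) / (s * φ s * (t * φ t)) - (1 - 2 * (u * v) / (s * t))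
      = -(2 * (u * v / (s * t))) * (φ u * φ v / (φ s * φ t) - 1) := by
    field_simp; ring
  rw [e3, abs_mul, abs_neg, abs_of_nonneg (by positivity)]
  nlinarith [abs_nonneg (φ u * φ v / (φ s * φ t) - 1)]

/-- First variation of the distance to a far away point in terms of comparison angles. -/
lemma cos_cangleK_first_variation (κ : ℝ) {s₀ η : ℝ} (hs₀ : snK κ s₀ ≠ 0) (hη : 0 < η) :
    ∃ R > 0, ∀ s t d : ℝ, |s - s₀| < R → 0 < t → t < R → |d - s| ≤ t →
    |Real.cos (cangleK κ s t d) - (s - d) / t| ≤ η := by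
  obtain ⟨φ, hφ, hlim⟩ := exists_snK_eq_mul κ
  have hF : Tendsto (fun z : (ℝ × ℝ) × (ℝ × ℝ) =>
      (snK κ (z.1.1) / snK κ (z.1.2)) * (φ z.2.1 / φ z.2.2))
      ((𝓝 s₀ ×ˢ 𝓝 s₀) ×ˢ (𝓝 0 ×ˢ 𝓝 0)) (𝓝 1) := by
    have hc := (continuous_snK κ).tendsto s₀
    have a := (hc.comp (tendsto_fst (f := 𝓝 s₀) (g := 𝓝 s₀))).div
      (hc.comp (tendsto_snd (f := 𝓝 s₀) (g := 𝓝 s₀))) hs₀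
    have b := (hlim.comp (tendsto_fst (f := 𝓝 (0 : ℝ)) (g := 𝓝 (0 : ℝ)))).div
      (hlim.comp (tendsto_snd (f := 𝓝 (0 : ℝ)) (g := 𝓝 (0 : ℝ)))) one_ne_zero
    have c := (a.comp (tendsto_fst (g := 𝓝 (0 : ℝ) ×ˢ 𝓝 (0 : ℝ)))).mul
      (b.comp (tendsto_snd (f := 𝓝 s₀ ×ˢ 𝓝 s₀)))
    rw [div_self hs₀, div_one, mul_one] at c
    exact c
  have hF' : ∀ᶠ z : (ℝ × ℝ) × (ℝ × ℝ) in 𝓝 ((s₀, s₀), (0, 0)),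
      |(snK κ (z.1.1) / snK κ (z.1.2)) * (φ z.2.1 / φ z.2.2) - 1| < η / 2 := by
    rw [nhds_prod_eq, nhds_prod_eq, nhds_prod_eq]
    have := (Metric.tendsto_nhds.1 hF) (η / 2) (by positivity)
    simpa [Real.dist_eq] using this
  obtain ⟨R1, hR1, H1⟩ := Metric.eventually_nhds_iff.1 hF'
  have hφ' : ∀ᶠ x in 𝓝 0, 0 < φ x := hlim.eventually (lt_mem_nhds zero_lt_one)
  obtain ⟨R2, hR2, H2⟩ := Metric.eventually_nhds_iff.1 hφ'
  obtain ⟨R3, hR3, H3⟩ := Metric.eventually_nhds_iff.1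
    ((continuous_snK κ).continuousAt.eventually_ne hs₀)
  refine ⟨min (min (R1 / 2) R2) R3, by positivity, fun s t d hsR ht htR hd => ?_⟩
  have hsR1 := hsR.trans_le ((min_le_left _ _).trans (min_le_left _ _))
  have htR1 := htR.trans_le ((min_le_left _ _).trans (min_le_left _ _))
  obtain ⟨hd3, hd4⟩ := abs_le.1 hd
  have pt : 0 < φ t := H2 (by
    rw [Real.dist_0_eq_abs, abs_of_pos ht]
    exact htR.trans_le ((min_le_left _ _).trans (min_le_right _ _)))
  have ns : snK κ s ≠ 0 := H3 (by rw [Real.dist_eq]; exact hsR.trans_le (min_le_right _ _))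
  have nt : snK κ t ≠ 0 := by rw [hφ]; positivity
  set u := (d + s - t) / 2 with hu
  set v := (d - s + t) / 2 with hv
  have hv0 : 0 ≤ v := by rw [hv]; linarith
  have hvt : v ≤ t := by rw [hv]; linarith
  obtain ⟨hs1, hs2⟩ := abs_lt.1 hsR1
  have key := @H1 ((u, s), (v, t)) (by
    rw [Prod.dist_eq, Prod.dist_eq, Prod.dist_eq]
    simp only [Real.dist_eq, max_lt_iff]
    refine ⟨⟨?_, ?_⟩, ?_, ?_⟩ <;> rw [abs_lt] <;> constructor <;> linarith)
  simp only at key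
  have e1 : (s - d) / t = 1 - 2 * (v / t) := by
    rw [hv]; field_simp; ring
  have q0 : 0 ≤ v / t := by positivity
  have q1 : v / t ≤ 1 := by
    rw [div_le_one (by positivity)]; exact hvt
  rw [cangleK_eq d ns nt, e1, ← hu, ← hv]
  refine (abs_cos_arccos_sub_le (by linarith) (by linarith)).trans ?_
  rw [hφ v, hφ t]
  have e3 : 1 - 2 * (snK κ u * (v * φ v)) / (snK κ s * (t * φ t)) - (1 - 2 * (v / t))
      = -(2 * (v / t)) * ((snK κ u / snK κ s) * (φ v / φ t) - 1) := by
    field_simp; ring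
  rw [e3, abs_mul, abs_neg, abs_of_nonneg (by positivity)]
  nlinarith [abs_nonneg ((snK κ u / snK κ s) * (φ v / φ t) - 1)]

section Local

variable {X : Type*} [MetricSpace X] {κ : ℝ}

lemma exists_dist_eq_mul [CompleteSpace X]
    (hmid : ∀ x y : X, ∃ z : X, dist x z = dist x y / 2 ∧ dist z y = dist x y / 2)
    (x y : X) {l : ℝ} (h0 : 0 ≤ l) (h1 : l ≤ 1) :
    ∃ w, dist x w = l * dist x y ∧ dist w y = (1 - l) * dist x y := by
  have step : ∀ s : X × X × Set.Icc (0 : ℝ) 1, ∃ s' : X × X × Set.Icc (0 : ℝ) 1,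
      dist s'.1 s'.2.1 = dist s.1 s.2.1 / 2 ∧
      dist s.1 s'.1 ≤ s.2.2 * dist s.1 s.2.1 - s'.2.2 * dist s'.1 s'.2.1 ∧
      dist s'.2.1 s.2.1 ≤
        (1 - s.2.2) * dist s.1 s.2.1 - (1 - s'.2.2) * dist s'.1 s'.2.1 := by
    rintro ⟨a, b, ⟨m, hm0, hm1⟩⟩
    obtain ⟨z, hz1, hz2⟩ := hmid a b
    rcases le_total m (1 / 2) with hm | hm
    · refine ⟨(a, z, ⟨2 * m, by linarith, by linarith⟩), hz1, ?_, ?_⟩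
      · simp only [dist_self, hz1]; linarith
      · simp only [hz1, hz2]; linarith
    · refine ⟨(z, b, ⟨2 * m - 1, by linarith, by linarith⟩), hz2, ?_, ?_⟩
      · simp only [hz1, hz2]; linarith
      · simp only [dist_self, hz2]; linarith
  choose F hF1 hF2 hF3 using step
  let s : ℕ → X × X × Set.Icc (0 : ℝ) 1 := fun n => F^[n] (x, y, ⟨l, h0, h1⟩)
  have hs (n : ℕ) : s (n + 1) = F (s n) := Function.iterate_succ_apply' _ _ _
  have hD (n : ℕ) : dist (s n).1 (s n).2.1 = dist x y * (1 / 2) ^ n := by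
    induction n with
    | zero => simp [s]
    | succ n ih => rw [hs, hF1, ih, pow_succ]; ring
  have hx (n : ℕ) : dist x (s n).1 ≤ l * dist x y - (s n).2.2 * dist (s n).1 (s n).2.1 := by
    induction n with
    | zero => simp [s]
    | succ n ih =>
      have := hF2 (s n)
      rw [← hs] at this
      linarith [dist_triangle x (s n).1 (s (n + 1)).1]
  have hy (n : ℕ) : dist (s n).2.1 y ≤
      (1 - l) * dist x y - (1 - (s n).2.2) * dist (s n).1 (s n).2.1 := by
    induction n with
    | zero => simp [s]
    | succ n ih =>
      have := hF3 (s n)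
      rw [← hs] at this
      linarith [dist_triangle (s (n + 1)).2.1 (s n).2.1 y]
  have hc (n : ℕ) : dist (s n).1 (s (n + 1)).1 ≤ dist x y * (1 / 2) ^ n := by
    have h := hF2 (s n)
    rw [← hs] at h
    rw [← hD n]
    have h2 := (s n).2.2.2.2
    have h3 := (s (n + 1)).2.2.2.1
    have := mul_nonneg h3 (dist_nonneg (x := (s (n + 1)).1) (y := (s (n + 1)).2.1))
    nlinarith [dist_nonneg (x := (s n).1) (y := (s n).2.1)]
  obtain ⟨w, hw⟩ := cauchySeq_tendsto_of_complete
    (cauchySeq_of_le_geometric (1 / 2) _ (by norm_num) hc)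
  have hzero : Tendsto (fun n => dist (s n).1 (s n).2.1) atTop (𝓝 0) := by
    simp_rw [hD]
    simpa using (tendsto_pow_atTop_nhds_zero_of_lt_one (r := (1 / 2 : ℝ)) (by norm_num)
      (by norm_num)).const_mul (dist x y)
  have hw' : Tendsto (fun n => (s n).2.1) atTop (𝓝 w) := hw.congr_dist hzero
  have b1 : dist x w ≤ l * dist x y := by
    refine le_of_tendsto (tendsto_const_nhds.dist hw) (Eventually.of_forall fun n => ?_)
    have := mul_nonneg (s n).2.2.2.1 (dist_nonneg (x := (s n).1) (y := (s n).2.1))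
    linarith [hx n]
  have b2 : dist w y ≤ (1 - l) * dist x y := by
    refine le_of_tendsto (hw'.dist tendsto_const_nhds) (Eventually.of_forall fun n => ?_)
    have := mul_nonneg (sub_nonneg.2 (s n).2.2.2.2)
      (dist_nonneg (x := (s n).1) (y := (s n).2.1))
    linarith [hy n]
  have b3 := dist_triangle x w y
  exact ⟨w, by linarith, by linarith⟩

lemma cangle_mem (q p r : X) : 0 ≤ cangle κ q p r ∧ cangle κ q p r ≤ π := cangleK_mem _ _ _ _

/-- In small regions the `κ`-comparison angles are close to the Euclidean ones. -/
lemma cos_cangle_approx (X : Type*) [MetricSpace X] (κ : ℝ) {η : ℝ} (hη : 0 < η) :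
    ∃ R > 0, ∀ p q r : X, dist p q < R → dist p r < R →
    |Real.cos (cangle κ q p r) * (2 * dist p q * dist p r)
      - (dist p q ^ 2 + dist p r ^ 2 - dist q r ^ 2)| ≤ η * (2 * dist p q * dist p r) := by
  obtain ⟨R, hR, H⟩ := cos_cangleK_approx κ hη
  refine ⟨R, hR, fun p q r hq hr => ?_⟩
  rcases eq_or_ne p q with rfl | hpq
  · simp
  rcases eq_or_ne p r with rfl | hpr
  · simp [dist_comm]
  have h1 := dist_pos.2 hpq
  have h2 := dist_pos.2 hpr
  obtain ⟨-, -, h⟩ := H _ _ (dist q r) h1 h2 hq hr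
    (by rw [abs_le]; constructor <;>
      linarith [dist_triangle p q r, dist_triangle p r q, dist_comm q r])
    (by linarith [dist_triangle_left q r p])
  have h3 : 0 < 2 * dist p q * dist p r := by positivity
  have := mul_le_mul_of_nonneg_right h h3.le
  rwa [← abs_of_pos h3, ← abs_mul, sub_mul, abs_of_pos h3, div_mul_cancel₀ _ h3.ne'] at this

/-- On a short geodesic the comparison angle at an interior point is `π`. -/
lemma cangle_eq_pi (X : Type*) [MetricSpace X] (κ : ℝ) : ∃ R > 0, ∀ p q r : X,
    p ≠ q → p ≠ r → dist p q < R → dist p r < R → dist q r = dist p q + dist p r →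
    cangle κ q p r = π := by
  obtain ⟨R, hR, H⟩ := cos_cangleK_approx κ one_pos
  refine ⟨R, hR, fun p q r hpq hpr hq hr hqr => ?_⟩
  have h1 := dist_pos.2 hpq
  have h2 := dist_pos.2 hpr
  obtain ⟨n1, n2, -⟩ := H _ _ (dist q r) h1 h2 hq hr
    (by rw [hqr, abs_le]; constructor <;> linarith) hqr.le
  unfold cangle
  rw [cangleK_eq _ n1 n2, hqr,
    show (dist p q + dist p r + dist p q - dist p r) / 2 = dist p q by ring,
    show (dist p q + dist p r - dist p q + dist p r) / 2 = dist p r by ring, mul_div_assoc,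
    div_self (mul_ne_zero n1 n2)]
  norm_num

lemma IsAlexandrov.cos_add_cos (hX : IsAlexandrov X κ) {p q r s : X} (hq : q ≠ p) (hr : r ≠ p)
    (hs : s ≠ p) :
    -(π - cangle κ q p r) ≤ Real.cos (cangle κ q p s) + Real.cos (cangle κ r p s) := by
  have h := hX.2.2 p q r s hq hr hs
  rw [cangle_comm κ s p q] at h
  set c := cangle κ q p r
  set a := cangle κ q p s with ha
  set b := cangle κ r p s with hb
  have ha' : 0 ≤ a ∧ a ≤ π := cangle_mem _ _ _
  have hb' : 0 ≤ b ∧ b ≤ π := cangle_mem _ _ _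
  have hc' : 0 ≤ c ∧ c ≤ π := cangle_mem _ _ _
  rcases le_total b (c - a + 0) with h1 | h1
  · have e1 : Real.cos (π - a) ≤ Real.cos b :=
      Real.cos_le_cos_of_nonneg_of_le_pi hb'.1 (by linarith) (by linarith)
    rw [Real.cos_pi_sub] at e1
    linarith
  · rcases le_total (a + b) π with h2 | h2
    · have e1 : Real.cos (π - a) ≤ Real.cos b :=
        Real.cos_le_cos_of_nonneg_of_le_pi hb'.1 (by linarith) (by linarith)
      rw [Real.cos_pi_sub] at e1
      linarith
    · have e1 := Real.abs_cos_sub_cos_le b (π - a)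
      rw [Real.cos_pi_sub, abs_of_nonneg (by linarith : 0 ≤ b - (π - a))] at e1
      have e2 := (abs_le.1 e1).1
      linarith

/-- Approximate monotonicity of Euclidean comparison angles at small scale. -/
lemma IsAlexandrov.approx_monotone (hX : IsAlexandrov X κ) {η : ℝ} (hη : 0 < η) :
    ∃ R > 0, ∀ (z x y w : X) (l : ℝ), 0 ≤ l → l ≤ 1 → dist z w = l * dist z x →
      dist w x = (1 - l) * dist z x → dist z x < R → dist z y < R →
      (l * dist z x) ^ 2 + dist z y ^ 2 - dist w y ^ 2 ≤
        l * (dist z x ^ 2 + dist z y ^ 2 - dist x y ^ 2) + 4 * η * dist w y * (l * dist z x) := by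
  obtain ⟨R1, hR1, H1⟩ := cos_cangle_approx X κ hη
  obtain ⟨R2, hR2, H2⟩ := cangle_eq_pi X κ
  refine ⟨min R1 R2 / 2, by positivity, fun z x y w l h0 h1 hzw hwx hzx hzy => ?_⟩
  have m1 := min_le_left R1 R2
  have m2 := min_le_right R1 R2
  rcases eq_or_lt_of_le h0 with rfl | h0'
  · have : z = w := dist_eq_zero.1 (by simpa using hzw)
    subst this; simp
  rcases eq_or_lt_of_le h1 with rfl | h1'
  · have : w = x := dist_eq_zero.1 (by simpa using hwx)
    subst this
    have : 0 ≤ 4 * η * dist w y * (1 * dist z w) := by positivity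
    linarith
  rcases eq_or_ne z x with rfl | hzx'
  · have : z = w := dist_eq_zero.1 (by simpa using hzw)
    subst this; simp
  have hL := dist_pos.2 hzx'
  rcases eq_or_ne w y with rfl | hwy
  · rw [hzw, dist_comm x w, hwx, dist_self]; nlinarith
  have hu := dist_pos.2 hwy
  have pwz : 0 < dist w z := by rw [dist_comm, hzw]; positivity
  have pwx : 0 < dist w x := by rw [hwx]; exact mul_pos (by linarith) hL
  have hwz' : dist w z = l * dist z x := by rw [dist_comm, hzw]
  have l1 : l * dist z x ≤ dist z x := by nlinarith
  have l2 : (1 - l) * dist z x ≤ dist z x := by nlinarith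
  have hpi := H2 w z x (dist_pos.1 pwz) (dist_pos.1 pwx) (by linarith) (by linarith)
    (by rw [hwz', hwx]; ring)
  have h4 := hX.cos_add_cos (dist_pos.1 pwz).symm (dist_pos.1 pwx).symm hwy.symm
  rw [hpi, sub_self, neg_zero] at h4
  have wy : dist w y ≤ l * dist z x + dist z y := by
    rw [← hzw]; exact dist_triangle_left w y z
  have a1 := (abs_le.1 (H1 w z y (by linarith) (by linarith))).2
  have a2 := (abs_le.1 (H1 w x y (by linarith) (by linarith))).2
  rw [hwz'] at a1
  rw [hwx] at a2
  set L := dist z x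
  set u := dist w y
  set c1 := Real.cos (cangle κ z w y)
  set c2 := Real.cos (cangle κ x w y)
  -- combine the two estimates with weights `1 - l` and `l`
  have b1 := mul_le_mul_of_nonneg_left a1 (by linarith : (0 : ℝ) ≤ 1 - l)
  have b2 := mul_le_mul_of_nonneg_left a2 h0
  have pos : 0 ≤ 2 * l * (1 - l) * L * u := by
    have : 0 < 1 - l := by linarith
    positivity
  have b3 := mul_nonneg pos h4
  have b4 : η * u * L * l * l ≥ 0 := by positivity
  nlinarith [b1, b2, b3, b4]

/-- Contraction towards a point shrinks distances at most by a definite factor. -/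
lemma IsAlexandrov.contraction (hX : IsAlexandrov X κ) {K : ℝ} (hK : 0 < K) :
    ∃ R > 0, ∀ (r : ℝ) (z x y w v : X) (l : ℝ), 0 ≤ l → l ≤ 1 → 0 < r → r < R →
      dist z w = l * dist z x → dist w x = (1 - l) * dist z x →
      dist z v = l * dist z y → dist v y = (1 - l) * dist z y →
      dist z x ≤ 3 * r → dist z y ≤ 3 * r → r / K ≤ dist x y →
      l * dist x y / 2 ≤ dist w v := by
  have hη : (0 : ℝ) < 1 / (192 * K ^ 2) := by positivity
  obtain ⟨R, hR, H⟩ := hX.approx_monotone hη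
  refine ⟨R / 3, by positivity, fun r z x y w v l h0 h1 hr0 hr hw1 hw2 hv1 hv2 hx hy hxy => ?_⟩
  set η : ℝ := 1 / (192 * K ^ 2) with hηd
  have l1 : l * dist z y ≤ dist z y := by nlinarith [dist_nonneg (x := z) (y := y)]
  have l2 : l * dist z x ≤ dist z x := by nlinarith [dist_nonneg (x := z) (y := x)]
  have a1 := H z y x v l h0 h1 hv1 hv2 (by linarith) (by linarith)
  have a2 := H z x v w l h0 h1 hw1 hw2 (by linarith) (by linarith)
  rw [hv1] at a2
  have t1 : dist v x ≤ 6 * r := by linarith [dist_triangle_left v x z]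
  have t2 : dist w v ≤ l * (6 * r) := by
    have := dist_triangle_left w v z
    nlinarith
  have hK2 : 144 * η * r ^ 2 ≤ 3 / 4 * dist x y ^ 2 := by
    have : (r / K) ^ 2 ≤ dist x y ^ 2 := by gcongr
    have e : 144 * η * r ^ 2 = 3 / 4 * (r / K) ^ 2 := by
      rw [hηd]; field_simp; norm_num
    rw [e]; gcongr
  rw [dist_comm x v, dist_comm y x] at *
  have e1 : dist v x * (l * dist z y) ≤ (6 * r) * (l * (3 * r)) := by gcongr
  have e2 : dist w v * (l * dist z x) ≤ (l * (6 * r)) * (l * (3 * r)) := by gcongr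
  have e3 : l * (dist v x * (l * dist z y)) ≤ l * ((6 * r) * (l * (3 * r))) := by gcongr
  have e4 := mul_le_mul_of_nonneg_left e3 hη.le
  have e5 := mul_le_mul_of_nonneg_left e2 hη.le
  have a1' := mul_le_mul_of_nonneg_left a1 h0
  have e6 : l ^ 2 * (144 * η * r ^ 2) ≤ l ^ 2 * (3 / 4 * dist x y ^ 2) := by gcongr
  have fin : (l * dist x y / 2) ^ 2 ≤ dist w v ^ 2 := by nlinarith
  exact (le_abs_self _).trans (abs_le_of_sq_le_sq fin dist_nonneg)

end Local

lemma le_dimH_of_branching {X : Type*} [MetricSpace X] [CompleteSpace X] (z₀ : X) {a b ε : ℝ}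
    {N m : ℕ} (ha : 0 < a) (hb : 0 < b) (hε : 0 < ε) (hε2 : ε ≤ 1 / 2) (hab : 4 * a * ε ≤ b / 2)
    (hN : 1 < N) (hNε : 1 ≤ N * ε ^ m) (hm : 0 < m)
    (h : ∀ z, dist z z₀ ≤ 2 * a → ∀ j : ℕ, ∃ w : Fin N → X,
      (∀ l, dist (w l) z ≤ a * ε ^ j) ∧ ∀ l l', l ≠ l' → b * ε ^ j ≤ dist (w l) (w l')) :
    (m : ℝ≥0∞) ≤ dimH (univ : Set X) := by
  have h' : ∀ z, ∀ j : ℕ, ∃ w : Fin N → X, dist z z₀ ≤ 2 * a →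
      (∀ l, dist (w l) z ≤ a * ε ^ j) ∧ ∀ l l', l ≠ l' → b * ε ^ j ≤ dist (w l) (w l') := by
    intro z j
    by_cases hz : dist z z₀ ≤ 2 * a
    · obtain ⟨w, hw⟩ := h z hz j
      exact ⟨w, fun _ => hw⟩
    · exact ⟨fun _ => z, fun hz' => absurd hz' hz⟩
  choose w hw using h'
  let Z : (ℕ → Fin N) → ℕ → X := fun s j => Nat.rec z₀ (fun j z => w z j (s j)) j
  have Zs (s j) : Z s (j + 1) = w (Z s j) j (s j) := rfl
  have hpow (j : ℕ) : 0 < ε ^ j := pow_pos hε j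
  have hZ (s j) : dist (Z s j) z₀ ≤ 2 * a * (1 - ε ^ j) := by
    induction j with
    | zero => simp [Z]
    | succ j ih =>
      have h1 : dist (Z s j) z₀ ≤ 2 * a :=
        ih.trans (by nlinarith [hpow j, mul_pos ha (hpow j)])
      have h2 := (hw _ j h1).1 (s j)
      rw [← Zs] at h2
      have h3 := dist_triangle (Z s (j + 1)) (Z s j) z₀
      have h4 : ε ^ (j + 1) = ε ^ j * ε := pow_succ _ _
      rw [h4]
      nlinarith [mul_pos ha (hpow j)]
  have hZ' (s j) : dist (Z s j) z₀ ≤ 2 * a :=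
    (hZ s j).trans (by nlinarith [hpow j, mul_pos ha (hpow j)])
  have hstep (s j) : dist (Z s j) (Z s (j + 1)) ≤ a * ε ^ j := by
    rw [dist_comm, Zs]; exact (hw _ j (hZ' s j)).1 _
  have hε1 : ε < 1 := by linarith
  have hlim (s) : ∃ x, Tendsto (Z s) atTop (𝓝 x) :=
    cauchySeq_tendsto_of_complete (cauchySeq_of_le_geometric ε a hε1 (hstep s))
  choose Φ hΦ using hlim
  have hΦd (s j) : dist (Z s j) (Φ s) ≤ 2 * a * ε ^ j := by
    refine (dist_le_of_le_geometric_of_tendsto ε a hε1 (hstep s) (hΦ s) j).trans ?_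
    rw [div_le_iff₀ (by linarith)]
    nlinarith [mul_pos ha (hpow j)]
  have hagree (s s' : ℕ → Fin N) (j : ℕ) (hs : ∀ i < j, s i = s' i) : Z s j = Z s' j := by
    induction j with
    | zero => rfl
    | succ j ih => rw [Zs, Zs, ih fun i hi => hs i (hi.trans j.lt_succ_self), hs j j.lt_succ_self]
  have hsep (s s' : ℕ → Fin N) (hne : s ≠ s') :
      b / 2 * ε ^ PiNat.firstDiff s s' ≤ dist (Φ s) (Φ s') := by
    set j := PiNat.firstDiff s s'
    have h1 : Z s j = Z s' j := hagree s s' j fun i hi => PiNat.apply_eq_of_lt_firstDiff (E := fun _ => Fin N) hi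
    have h2 : b * ε ^ j ≤ dist (Z s (j + 1)) (Z s' (j + 1)) := by
      rw [Zs, Zs, h1]
      exact (hw _ j (hZ' s' j)).2 _ _ (PiNat.apply_firstDiff_ne hne)
    have h3 := hΦd s (j + 1)
    have h4 := hΦd s' (j + 1)
    have h5 := dist_triangle4 (Z s (j + 1)) (Φ s) (Φ s') (Z s' (j + 1))
    rw [dist_comm (Φ s') (Z s' (j + 1))] at h5
    rw [pow_succ] at h3 h4
    nlinarith [mul_le_mul_of_nonneg_right hab (hpow j).le]
  have hinj : Function.Injective Φ := by
    intro s s' hs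
    by_contra hne
    have := hsep s s' hne
    rw [hs, dist_self] at this
    nlinarith [mul_pos hb (hpow (PiNat.firstDiff s s'))]
  have : Nonempty (Fin N) := ⟨⟨0, by omega⟩⟩
  let Ψ : X → ℝ := fun x => Real.ofDigits (Function.invFun Φ x)
  have hΨ (s) : Ψ (Φ s) = Real.ofDigits s := by
    simp only [Ψ, Function.leftInverse_invFun hinj s]
  have hNpos : (0 : ℝ) < N := by exact_mod_cast (by omega : 0 < N)
  have hhol (s s') : dist (Ψ (Φ s)) (Ψ (Φ s')) ≤ (2 / b) ^ m * dist (Φ s) (Φ s') ^ m := by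
    by_cases hne : s = s'
    · subst hne; simp only [dist_self]; positivity
    have h1 := hsep s s' hne
    set j := PiNat.firstDiff s s'
    rw [hΨ, hΨ, Real.dist_eq]
    refine (Real.abs_ofDigits_sub_ofDigits_le (n := j)
      fun i hi => PiNat.apply_eq_of_lt_firstDiff (E := fun _ => Fin N) hi).trans ?_
    have h2 : ((N : ℝ) ^ j)⁻¹ ≤ (ε ^ j) ^ m := by
      rw [inv_le_iff_one_le_mul₀ (by positivity), ← pow_mul, mul_comm j m, pow_mul, ← mul_pow,
        mul_comm]
      exact one_le_pow₀ hNε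
    refine h2.trans ?_
    rw [← mul_pow]
    gcongr
    rw [div_mul_eq_mul_div, le_div_iff₀ hb]
    linarith
  have hH : HolderOnWith (Real.toNNReal ((2 / b) ^ m)) (m : ℝ≥0) Ψ (range Φ) := by
    rintro _ ⟨s, rfl⟩ _ ⟨s', rfl⟩
    rw [edist_dist, edist_dist, NNReal.coe_natCast, ENNReal.rpow_natCast,
      ← ENNReal.ofReal_pow dist_nonneg, ENNReal.ofNNReal_toNNReal,
      ← ENNReal.ofReal_mul (by positivity)]
    exact ENNReal.ofReal_le_ofReal (hhol s s')
  have himg : Icc (0 : ℝ) 1 ⊆ Ψ '' range Φ := by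
    intro x hx
    obtain ⟨s, -, hs⟩ := Real.ofDigits_SurjOn hN hx
    exact ⟨Φ s, ⟨s, rfl⟩, by rw [hΨ, hs]⟩
  have hm' : (0 : ℝ≥0) < m := by exact_mod_cast hm
  have h1 : (1 : ℝ≥0∞) ≤ dimH (univ : Set X) / (m : ℝ≥0) := by
    have hI : dimH (Icc (0 : ℝ) 1) = 1 := by
      rw [Real.dimH_of_nonempty_interior (by simp)]; simp
    calc (1 : ℝ≥0∞) = dimH (Icc (0 : ℝ) 1) := hI.symm
      _ ≤ dimH (Ψ '' range Φ) := dimH_mono himg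
      _ ≤ dimH (range Φ) / (m : ℝ≥0) := hH.dimH_image_le hm'
      _ ≤ _ := by exact ENNReal.div_le_div_right (dimH_mono (subset_univ _)) _
  rw [ENNReal.le_div_iff_mul_le (Or.inl (by exact_mod_cast hm'.ne')) (Or.inl ENNReal.coe_ne_top)]
    at h1
  simpa using h1

section Packing

variable {X : Type*} [MetricSpace X] {κ : ℝ}

/-- Uniform packing bound in balls of a finite dimensional Alexandrov space. -/
lemma IsAlexandrov.card_le_of_separated (hX : IsAlexandrov X κ) {n : ℕ}
    (hdim : dimH (univ : Set X) = n) {K : ℝ} (hK : 1 ≤ K) :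
    ∃ N : ℕ, ∃ R > 0, ∀ (p : X) (r : ℝ), 0 < r → r < R → ∀ A : Finset X,
      (∀ x ∈ A, dist x p ≤ r) → (∀ x ∈ A, ∀ y ∈ A, x ≠ y → r / K ≤ dist x y) →
      A.card ≤ N := by
  have : CompleteSpace X := hX.1
  obtain ⟨R, hR, hc⟩ := hX.contraction (by linarith : 0 < K)
  set ε : ℝ := 1 / (48 * K) with hεdef
  have hε : 0 < ε := by positivity
  have hεK : ε * K = 1 / 48 := by rw [hεdef]; field_simp
  have hε1 : ε ≤ 1 / 48 := by nlinarith
  obtain ⟨N, hN⟩ := exists_nat_ge ((ε ^ (n + 1))⁻¹)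
  refine ⟨max N 2, R, hR, fun p r hr hrR A hA hsep => ?_⟩
  by_contra! hcard
  have hcard' : Fintype.card (Fin (max N 2)) ≤ Fintype.card A := by
    simpa using hcard.le
  obtain ⟨y⟩ := Function.Embedding.nonempty_of_card_le hcard'
  have hpow (j : ℕ) : 0 < ε ^ j := pow_pos hε j
  have key : ((n + 1 : ℕ) : ℝ≥0∞) ≤ dimH (univ : Set X) := by
    refine le_dimH_of_branching p (a := r) (b := r / (6 * K)) (ε := ε) (N := max N 2) hr
      (by positivity) hε (by linarith) ?_ (by omega) ?_ (by omega) ?_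
    · rw [hεdef]; apply le_of_eq; field_simp; norm_num
    · have h1 : (N : ℝ) ≤ (max N 2 : ℕ) := by exact_mod_cast le_max_left _ _
      have h2 := hN.trans h1
      rwa [inv_le_iff_one_le_mul₀ (hpow _)] at h2
    · intro z hz j
      have hl0 : 0 ≤ ε ^ j / 3 := by have := hpow j; positivity
      have hl1 : ε ^ j / 3 ≤ 1 := by
        have : ε ^ j ≤ 1 := pow_le_one₀ hε.le (by linarith)
        linarith
      have hy (l) : dist z (y l : X) ≤ 3 * r := by
        have := dist_triangle_right z (y l : X) p
        have := hA _ (y l).2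
        linarith
      choose w hw1 hw2 using fun l => exists_dist_eq_mul hX.2.1 z (y l : X) hl0 hl1
      refine ⟨w, fun l => ?_, fun l l' hll => ?_⟩
      · rw [dist_comm, hw1]; nlinarith [hy l]
      · have hs : r / K ≤ dist (y l : X) (y l') :=
          hsep _ (y l).2 _ (y l').2 fun hh => hll (y.injective (Subtype.ext hh))
        refine le_trans ?_ (hc r z _ _ _ _ _ hl0 hl1 hr hrR (hw1 l) (hw2 l) (hw1 l') (hw2 l')
          (hy l) (hy l') hs)
        have : r / (6 * K) = r / K / 6 := by field_simp
        rw [this]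
        nlinarith [mul_le_mul_of_nonneg_left hs hl0]
  rw [hdim] at key
  exact absurd (by exact_mod_cast key : n + 1 ≤ n) (by omega)

/-- A set whose finite `s`-separated subsets have at most `N` points is covered by
`N` closed balls of radius `s` centred in the set. -/
lemma exists_cover_of_card_le {S : Set X} {s : ℝ} (hs : 0 ≤ s) {N : ℕ}
    (h : ∀ A : Finset X, (A : Set X) ⊆ S → (∀ x ∈ A, ∀ y ∈ A, x ≠ y → s ≤ dist x y) →
      A.card ≤ N) :
    ∃ F : Finset X, (F : Set X) ⊆ S ∧ F.card ≤ N ∧ ∀ x ∈ S, ∃ c ∈ F, dist x c ≤ s := by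
  classical
  let P : ℕ → Prop := fun k => ∃ A : Finset X, (A : Set X) ⊆ S ∧
    (∀ x ∈ A, ∀ y ∈ A, x ≠ y → s ≤ dist x y) ∧ A.card = k
  have hP0 : P 0 := ⟨∅, by simp, by simp, by simp⟩
  obtain ⟨A, hAS, hA, hk⟩ : P (Nat.findGreatest P N) := Nat.findGreatest_spec (Nat.zero_le N) hP0
  refine ⟨A, hAS, h A hAS hA, fun x hx => ?_⟩
  by_contra! hfar
  by_cases hxA : x ∈ A
  · exact absurd (hfar x hxA) (by simpa using hs)
  have hB : (∀ u ∈ insert x A, ∀ v ∈ insert x A, u ≠ v → s ≤ dist u v) := by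
    intro u hu v hv huv
    rw [Finset.mem_insert] at hu hv
    rcases hu with rfl | hu <;> rcases hv with rfl | hv
    · exact absurd rfl huv
    · exact (hfar v hv).le
    · rw [dist_comm]; exact (hfar u hu).le
    · exact hA u hu v hv huv
  have hBS : ((insert x A : Finset X) : Set X) ⊆ S := by
    rw [Finset.coe_insert]; exact insert_subset hx hAS
  have hcard : (insert x A).card = Nat.findGreatest P N + 1 := by
    rw [Finset.card_insert_of_notMem hxA, hk]
  have := Nat.le_findGreatest (P := P) (hcard ▸ h _ hBS hB) ⟨_, hBS, hB, hcard⟩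
  omega

end Packing

section Covering

variable {X : Type*} [MetricSpace X]

lemma exists_cover_iterate {T : Set X} {r₀ q : ℝ} (hr₀ : 0 < r₀) (hq : 0 < q) (hq1 : q ≤ 1)
    {P : ℕ}
    (h : ∀ x ∈ T, ∀ r, 0 < r → r ≤ r₀ → ∃ F : Finset X, (F : Set X) ⊆ T ∧ F.card ≤ P ∧
      ∀ y ∈ T, dist y x ≤ r → ∃ c ∈ F, dist y c ≤ q * r) {x : X} (hx : x ∈ T) (j : ℕ) :
    ∃ F : Finset X, (F : Set X) ⊆ T ∧ F.card ≤ P ^ j ∧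
      ∀ y ∈ T, dist y x ≤ r₀ → ∃ c ∈ F, dist y c ≤ q ^ j * r₀ := by
  classical
  induction j with
  | zero => exact ⟨{x}, by simpa using hx, by simp, fun y _ hy => ⟨x, by simp, by simpa using hy⟩⟩
  | succ j ih =>
    obtain ⟨F, hFT, hFc, hF⟩ := ih
    have hpos : 0 < q ^ j * r₀ := by positivity
    have hle : q ^ j * r₀ ≤ r₀ := mul_le_of_le_one_left hr₀.le (pow_le_one₀ hq.le hq1)
    choose! G hGT hGc hG using fun c (hc : c ∈ T) => h c hc _ hpos hle
    refine ⟨F.biUnion G, ?_, ?_, fun y hy hyx => ?_⟩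
    · intro y hy
      obtain ⟨c, hc, hy⟩ := Finset.mem_biUnion.1 (Finset.mem_coe.1 hy)
      exact hGT c (hFT hc) hy
    · refine (Finset.card_biUnion_le_card_mul F G P fun c hc => hGc c (hFT hc)).trans ?_
      rw [pow_succ]
      exact Nat.mul_le_mul_right P hFc
    · obtain ⟨c, hc, hyc⟩ := hF y hy hyx
      obtain ⟨c', hc', hyc'⟩ := hG c (hFT hc) y hy hyc
      exact ⟨c', Finset.mem_biUnion.2 ⟨c, hc, hc'⟩, hyc'.trans (le_of_eq (by rw [pow_succ]; ring))⟩

lemma dimH_le_of_cover {T : Set X} {r₀ q : ℝ} (hr₀ : 0 < r₀) (hq : 0 < q) (hq1 : q < 1)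
    {P : ℕ} {d : ℝ≥0} (hP : P * q ^ (d : ℝ) ≤ 1)
    (h : ∀ x ∈ T, ∀ r, 0 < r → r ≤ r₀ → ∃ F : Finset X, (F : Set X) ⊆ T ∧ F.card ≤ P ∧
      ∀ y ∈ T, dist y x ≤ r → ∃ c ∈ F, dist y c ≤ q * r) {x : X} (hx : x ∈ T) :
    dimH (T ∩ closedBall x r₀) ≤ d := by
  borelize X
  choose F hFT hFc hF using exists_cover_iterate hr₀ hq hq1.le h hx
  refine dimH_le_of_hausdorffMeasure_ne_top (ne_of_lt (lt_of_le_of_lt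
    (MeasureTheory.Measure.hausdorffMeasure_le_liminf_sum (l := atTop) (ι := fun j => F j) d _
      (fun j => ENNReal.ofReal (2 * (q ^ j * r₀))) ?_
      (fun j c => closedBall (c : X) (q ^ j * r₀)) ?_ ?_)
    (lt_of_le_of_lt (b := ENNReal.ofReal ((2 * r₀) ^ (d : ℝ))) ?_ ENNReal.ofReal_lt_top)))
  · have h1 := ((tendsto_pow_atTop_nhds_zero_of_lt_one hq.le hq1).mul_const r₀).const_mul 2
    simpa using ENNReal.tendsto_ofReal h1
  · refine Eventually.of_forall fun j c => ?_
    refine Metric.ediam_le_of_forall_dist_le fun u hu v hv => ?_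
    have := dist_triangle_right u v (c : X)
    rw [mem_closedBall] at hu hv
    linarith
  · refine Eventually.of_forall fun j y hy => ?_
    obtain ⟨c, hc, hyc⟩ := hF j y hy.1 hy.2
    exact mem_iUnion.2 ⟨⟨c, hc⟩, hyc⟩
  · have hbound (j : ℕ) : ∑ c : F j, ediam (closedBall (c : X) (q ^ j * r₀)) ^ (d : ℝ) ≤
        ENNReal.ofReal ((2 * r₀) ^ (d : ℝ)) := by
      have hterm (c : F j) : ediam (closedBall (c : X) (q ^ j * r₀)) ^ (d : ℝ) ≤
          ENNReal.ofReal ((2 * (q ^ j * r₀)) ^ (d : ℝ)) := by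
        rw [← ENNReal.ofReal_rpow_of_nonneg (by positivity) d.coe_nonneg]
        refine ENNReal.rpow_le_rpow (Metric.ediam_le_of_forall_dist_le fun u hu v hv => ?_) d.coe_nonneg
        have := dist_triangle_right u v (c : X)
        rw [mem_closedBall] at hu hv
        linarith
      refine (Finset.sum_le_sum fun c _ => hterm c).trans ?_
      rw [Finset.sum_const, nsmul_eq_mul, Finset.card_univ, Fintype.card_coe,
        ← ENNReal.ofReal_natCast, ← ENNReal.ofReal_mul (by positivity)]
      refine ENNReal.ofReal_le_ofReal ?_
      have e : (2 * (q ^ j * r₀)) ^ (d : ℝ) = (q ^ (d : ℝ)) ^ j * (2 * r₀) ^ (d : ℝ) := by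
        rw [show 2 * (q ^ j * r₀) = q ^ j * (2 * r₀) by ring,
          Real.mul_rpow (by positivity) (by positivity), ← Real.rpow_natCast q j,
          ← Real.rpow_mul hq.le, mul_comm (j : ℝ), Real.rpow_mul hq.le, Real.rpow_natCast]
      rw [e, ← mul_assoc]
      refine mul_le_of_le_one_left (by positivity) ?_
      calc ((F j).card : ℝ) * (q ^ (d : ℝ)) ^ j ≤ (P : ℝ) ^ j * (q ^ (d : ℝ)) ^ j := by
            gcongr; exact_mod_cast hFc j
        _ = (P * q ^ (d : ℝ)) ^ j := (mul_pow _ _ _).symm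
        _ ≤ 1 := pow_le_one₀ (by positivity) hP
    exact (liminf_le_liminf (Eventually.of_forall hbound)).trans (liminf_const _).le

lemma isCompact_closedBall_of_cover [CompleteSpace X] {r₀ q : ℝ} (hr₀ : 0 < r₀) (hq : 0 < q)
    (hq1 : q < 1) {P : ℕ}
    (h : ∀ x : X, ∀ r, 0 < r → r ≤ r₀ → ∃ F : Finset X, F.card ≤ P ∧
      ∀ y, dist y x ≤ r → ∃ c ∈ F, dist y c ≤ q * r) (x : X) :
    IsCompact (closedBall x r₀) := by
  rw [isCompact_iff_totallyBounded_isComplete]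
  refine ⟨Metric.totallyBounded_iff.2 fun ε hε => ?_, isClosed_closedBall.isComplete⟩
  obtain ⟨j, hj⟩ := exists_pow_lt_of_lt_one (div_pos hε hr₀) hq1
  obtain ⟨F, -, -, hF⟩ := exists_cover_iterate (T := univ) hr₀ hq hq1.le (P := P)
    (fun x _ r h0 h1 => by
      obtain ⟨F, hF1, hF2⟩ := h x r h0 h1
      exact ⟨F, subset_univ _, hF1, fun y _ => hF2 y⟩) (mem_univ x) j
  refine ⟨F, F.finite_toSet, fun y hy => ?_⟩
  obtain ⟨c, hc, hyc⟩ := hF y (mem_univ y) hy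
  rw [lt_div_iff₀ hr₀] at hj
  exact mem_iUnion₂.2 ⟨c, hc, hyc.trans_lt hj⟩

lemma secondCountableTopology_of_dimH_lt_top (h : dimH (univ : Set X) < ⊤) :
    SecondCountableTopology X := by
  borelize X
  refine Metric.secondCountable_of_almost_dense_set fun ε hε => ?_
  obtain ⟨d, hd, -⟩ := ENNReal.lt_iff_exists_nnreal_btwn.1 h
  have h0 := hausdorffMeasure_of_dimH_lt hd
  rw [MeasureTheory.Measure.hausdorffMeasure_apply] at h0
  have h1 := iSup_le_iff.1 (iSup_le_iff.1 h0.le (ENNReal.ofReal ε)) (ENNReal.ofReal_pos.2 hε)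
  obtain ⟨t, ht, htd⟩ : ∃ t : ℕ → Set X, univ ⊆ ⋃ n, t n ∧
      ∀ n, ediam (t n) ≤ ENNReal.ofReal ε := by
    by_contra! hno
    have : ∀ t : ℕ → Set X, (⨅ (_ : univ ⊆ ⋃ n, t n) (_ : ∀ n, ediam (t n) ≤ ENNReal.ofReal ε),
        ∑' n, ⨆ _ : (t n).Nonempty, ediam (t n) ^ (d : ℝ)) = ⊤ := by
      intro t
      refine iInf_eq_top.2 fun h1 => iInf_eq_top.2 fun h2 => ?_
      obtain ⟨n, hn⟩ := hno t h1
      exact absurd (h2 n) hn.not_ge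
    simp only [this] at h1
    simp at h1
  rcases isEmpty_or_nonempty X with hX | ⟨⟨x₀⟩⟩
  · exact ⟨∅, by simp, fun x => hX.elim x⟩
  have : ∀ n, ∃ c, ∀ x ∈ t n, dist x c ≤ ε := by
    intro n
    rcases (t n).eq_empty_or_nonempty with hn | ⟨c, hc⟩
    · exact ⟨x₀, by simp [hn]⟩
    · refine ⟨c, fun x hx => ?_⟩
      have := (Metric.edist_le_ediam_of_mem hx hc).trans (htd n)
      rwa [edist_dist, ENNReal.ofReal_le_ofReal_iff hε.le] at this
  choose c hc using this
  refine ⟨range c, countable_range c, fun x => ?_⟩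
  obtain ⟨n, hn⟩ := mem_iUnion.1 (ht (mem_univ x))
  exact ⟨c n, mem_range_self n, hc n x hn⟩

end Covering

section Straight

variable {X : Type*} [MetricSpace X] {κ : ℝ}

lemma IsAlexandrov.exists_scale_chain (hX : IsAlexandrov X κ) {n : ℕ}
    (hdim : dimH (univ : Set X) = n) {K : ℝ} (hK : 1 ≤ K) :
    ∃ N : ℕ, ∃ R > 0, ∀ (m : ℕ) (A : Finset X), N ^ m < A.card →
      (∀ x ∈ A, ∀ y ∈ A, dist x y < R) → ∃ p ∈ A, ∃ x : ℕ → X,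
        (∀ i < m, x i ∈ A ∧ x i ≠ p) ∧
          ∀ i j, i < j → j < m → K * dist p (x j) ≤ dist p (x i) := by
  classical
  obtain ⟨N, R, hR, hN⟩ := hX.card_le_of_separated hdim (K := 4 * K) (by linarith)
  refine ⟨max N 1, R, hR, fun m => ?_⟩
  induction m with
  | zero =>
    intro A hA _
    obtain ⟨p, hp⟩ := Finset.card_pos.1 ((Nat.zero_le _).trans_lt hA)
    exact ⟨p, hp, fun _ => p, by simp, by simp⟩
  | succ m ih =>
    intro A hA hAR
    have hA1 : 1 < A.card :=
      (Nat.one_le_pow _ _ (le_max_right N 1)).trans_lt hA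
    obtain ⟨a, ha, b, hb, hab⟩ := Finset.one_lt_card.1 hA1
    obtain ⟨⟨u, v⟩, huv, hmax⟩ := Finset.exists_max_image (A ×ˢ A) (fun s => dist s.1 s.2)
      ⟨(a, b), Finset.mk_mem_product ha hb⟩
    obtain ⟨hu, hv⟩ := Finset.mem_product.1 huv
    set D := dist u v with hDdef
    have hmax' : ∀ x ∈ A, ∀ y ∈ A, dist x y ≤ D := fun x hx y hy =>
      hmax (x, y) (Finset.mk_mem_product hx hy)
    have hD : 0 < D := (dist_pos.2 hab).trans_le (hmax' a ha b hb)
    obtain ⟨F, hFA, hFc, hF⟩ := exists_cover_of_card_le (S := (A : Set X)) (s := D / (4 * K))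
      (by positivity) (N := N) fun B hB hBs =>
        hN u D hD (hAR u hu v hv) B (fun x hx => hmax' x (hB hx) u hu) hBs
    choose! f hfF hf using hF
    obtain ⟨c, -, hc⟩ := Finset.exists_lt_card_fiber_of_mul_lt_card_of_maps_to
      (f := f) (s := A) (t := F) (n := max N 1 ^ m) (fun x hx => hfF x hx)
      ((Nat.mul_le_mul_right _ (hFc.trans (le_max_left N 1))).trans_lt
        (by rwa [pow_succ, mul_comm] at hA))
    obtain ⟨p, hp, x, hx, hxK⟩ := ih _ hc fun x hx y hy =>
      hAR x (Finset.mem_filter.1 hx).1 y (Finset.mem_filter.1 hy).1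
    obtain ⟨hpA, hpc⟩ := Finset.mem_filter.1 hp
    have hsmall : ∀ y ∈ A.filter (fun x => f x = c), K * dist p y ≤ D / 2 := by
      intro y hy
      obtain ⟨hyA, hyc⟩ := Finset.mem_filter.1 hy
      have h1 := hf p hpA
      have h2 := hf y hyA
      rw [hpc] at h1
      rw [hyc] at h2
      have h3 : dist p y ≤ 2 * (D / (4 * K)) := by
        have := dist_triangle_right p y c
        linarith
      calc K * dist p y ≤ K * (2 * (D / (4 * K))) := by gcongr
        _ = D / 2 := by field_simp; norm_num
    obtain ⟨w, hw, hwp⟩ : ∃ w ∈ A, D / 2 ≤ dist p w := by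
      by_contra! hno
      have h1 := hno u hu
      have h2 := hno v hv
      have := dist_triangle_left u v p
      linarith
    refine ⟨p, hpA, fun i => Nat.casesOn i w x, ?_, ?_⟩
    · rintro (_ | i) hi
      · refine ⟨hw, fun hwp' => ?_⟩
        change w = p at hwp'
        rw [hwp', dist_self] at hwp
        linarith
      · obtain ⟨h1, h2⟩ := hx i (by omega)
        exact ⟨(Finset.mem_filter.1 h1).1, h2⟩
    · rintro (_ | i) (_ | j) hij hj
      · omega
      · exact (hsmall _ (hx j (by omega)).1).trans hwp
      · omega
      · exact hxK i j (by omega) (by omega)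

lemma two_sub_mul_le_of_sides {A B D r h e τ η : ℝ} (hτ : 0 < τ) (hη : η = τ / 32)
    (hτ1 : τ ≤ 1) (hr : 0 < r) (hA : 0 < A) (hB : 0 < B) (hh : h ≤ 2 * A) (he0 : 0 ≤ e)
    (he : e ≤ r * τ / 2)
    (m1 : r ^ 2 + A ^ 2 - h ^ 2 ≤ r / B * (B ^ 2 + A ^ 2 - D ^ 2) + 4 * η * h * r)
    (m2 : r ^ 2 + r ^ 2 - e ^ 2 ≤ r / A * (A ^ 2 + r ^ 2 - h ^ 2) + 4 * η * e * r) :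
    (2 - τ) * (A * B) ≤ A ^ 2 + B ^ 2 - D ^ 2 := by
  have hη0 : 0 < η := by rw [hη]; positivity
  have he1 : e ≤ r := he.trans (by nlinarith)
  have he2 : e ^ 2 ≤ τ / 2 * r ^ 2 := by
    have h2 : e ^ 2 ≤ (r * τ / 2) ^ 2 := by gcongr
    nlinarith [mul_le_mul_of_nonneg_right hτ1 (mul_nonneg hτ.le (sq_nonneg r))]
  have s1 : r ^ 2 + A ^ 2 - h ^ 2 ≤ r / B * (A ^ 2 + B ^ 2 - D ^ 2) + 8 * η * A * r := by
    have := mul_le_mul_of_nonneg_left hh (by positivity : (0 : ℝ) ≤ 4 * η * r)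
    rw [add_comm (A ^ 2) (B ^ 2)]
    linarith
  have s2 : 2 * r ^ 2 - τ / 2 * r ^ 2 - 4 * η * r ^ 2 ≤ r / A * (r ^ 2 + A ^ 2 - h ^ 2) := by
    have := mul_le_mul_of_nonneg_left he1 (by positivity : (0 : ℝ) ≤ 4 * η * r)
    rw [add_comm (r ^ 2) (A ^ 2)]
    linarith
  have s3 := s2.trans (mul_le_mul_of_nonneg_left s1 (by positivity : (0 : ℝ) ≤ r / A))
  have s4 : r / A * (r / B * (A ^ 2 + B ^ 2 - D ^ 2) + 8 * η * A * r) =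
      r ^ 2 * ((A ^ 2 + B ^ 2 - D ^ 2) / (A * B) + 8 * η) := by
    field_simp
  have s5 : r ^ 2 * (2 - τ / 2 - 4 * η) ≤ r ^ 2 * ((A ^ 2 + B ^ 2 - D ^ 2) / (A * B) + 8 * η) := by
    rw [← s4]; linarith
  have s6 := le_of_mul_le_mul_left s5 (by positivity)
  rw [← le_div_iff₀ (by positivity)]
  linarith

lemma false_of_sides {A B D τ η c : ℝ} (hτ : 0 < τ) (hη : η = τ / 32)
    (hτ1 : τ ≤ 1) (hB : 0 < B) (hA : 0 < A)
    (hD : 0 < D) (hDA : D ≤ A + B) (hBA : B * 8 ≤ τ * A)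
    (hE : (2 - τ) * (A * B) ≤ A ^ 2 + B ^ 2 - D ^ 2) (hc : -(1 - 2 * τ) ≤ c)
    (h : -(η * (2 * B * D)) ≤ (B ^ 2 + D ^ 2 - A ^ 2) - c * (2 * B * D)) : False := by
  have h1 := mul_le_mul_of_nonneg_right hc (by positivity : 0 ≤ 2 * B * D)
  have h2 : B * ((2 - τ) * A - 2 * B) ≤ B * ((1 - 2 * τ + η) * (2 * D)) := by nlinarith
  have h3 := le_of_mul_le_mul_left h2 hB
  have h4 : (2 - 5 / 4 * τ) * A ≤ (1 - 2 * τ + η) * (2 * D) := by linarith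
  have h5 : 0 < (2 - 5 / 4 * τ) * A := mul_pos (by linarith) hA
  have hg : 0 < 1 - 2 * τ + η := by
    by_contra! hg
    have := mul_nonpos_of_nonpos_of_nonneg hg (by positivity : 0 ≤ 2 * D)
    linarith
  have h6 : D ≤ A * (1 + τ / 8) := by linarith
  have h7 := mul_le_mul_of_nonneg_left h6 hg.le
  have h8 : (1 - 2 * τ + η) * (1 + τ / 8) ≤ 1 - 7 / 4 * τ := by rw [hη]; nlinarith
  have h9 := mul_le_mul_of_nonneg_left h8 hA.le
  nlinarith [mul_pos hτ hA]

/-- Every sufficiently large finite set of small diameter contains a nearly straight triple. -/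
lemma IsAlexandrov.exists_nearly_straight (hX : IsAlexandrov X κ) {n : ℕ}
    (hdim : dimH (univ : Set X) = n) {δ : ℝ} (hδ : 0 < δ) (hδ1 : δ ≤ 1) :
    ∃ M : ℕ, ∃ R > 0, ∀ A : Finset X, M < A.card → (∀ x ∈ A, ∀ y ∈ A, dist x y < R) →
      ∃ x ∈ A, ∃ y ∈ A, ∃ z ∈ A, x ≠ y ∧ z ≠ y ∧ π - δ < cangle κ x y z := by
  classical
  have : CompleteSpace X := hX.1
  have hpi := Real.pi_gt_three
  set τ : ℝ := (1 - cos δ) / 2 with hτdef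
  have hτ : 0 < τ := by
    have := Real.cos_lt_cos_of_nonneg_of_le_pi le_rfl (by linarith) hδ
    rw [cos_zero] at this
    linarith
  have hτ1 : τ ≤ 1 := by
    have := Real.neg_one_le_cos δ
    linarith
  set η : ℝ := τ / 32 with hηdef
  have hη : 0 < η := by positivity
  set K : ℝ := 8 / τ with hKdef
  have hK8 : 8 ≤ K := by rw [hKdef, le_div_iff₀ hτ]; linarith
  have hKτ : K * τ = 8 := by rw [hKdef]; field_simp
  set K' : ℝ := 2 / τ with hKdef'
  have hK2 : 2 ≤ K' := by rw [hKdef', le_div_iff₀ hτ]; linarith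
  have hKτ' : K' * τ = 2 := by rw [hKdef']; field_simp
  obtain ⟨N, R₁, hR₁, hN⟩ := hX.exists_scale_chain hdim (K := K) (by linarith)
  obtain ⟨m, R₂, hR₂, hm⟩ := hX.card_le_of_separated hdim (K := K') (by linarith)
  obtain ⟨R₃, hR₃, hmono⟩ := hX.approx_monotone hη
  obtain ⟨R₄, hR₄, hcos⟩ := cos_cangle_approx X κ hη
  refine ⟨N ^ (m + 1), min (min R₁ R₂) (min R₃ R₄), by positivity, fun A hA hAR => ?_⟩
  simp only [lt_min_iff] at hAR
  obtain ⟨p, hp, x, hx, hxK⟩ := hN (m + 1) A hA fun u hu v hv => (hAR u hu v hv).1.1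
  set r := dist p (x m) with hr
  have hr0 : 0 < r := dist_pos.2 (hx m (by omega)).2.symm
  have hxr (i) (hi : i < m + 1) : r ≤ dist p (x i) := by
    rcases Nat.lt_succ_iff_lt_or_eq.1 hi with h | rfl
    · have := hxK i m h (by omega)
      nlinarith
    · exact le_rfl
  have hy (i : Fin (m + 1)) : ∃ y, dist p y = r / dist p (x i) * dist p (x i) ∧
      dist y (x i) = (1 - r / dist p (x i)) * dist p (x i) := by
    have hi := hxr i i.2
    exact exists_dist_eq_mul hX.2.1 p (x i) (by positivity)
      (by rw [div_le_one (by linarith)]; exact hi)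
  choose y hy1 hy2 using hy
  have hyr (i) : dist p (y i) = r := by
    have hi := hxr i i.2
    rw [hy1, div_mul_cancel₀]
    linarith
  obtain ⟨i, j, hij, hclose⟩ : ∃ i j : Fin (m + 1), i < j ∧ dist (y i) (y j) < r / K' := by
    by_contra! hno
    have hno' : ∀ i j, i ≠ j → r / K' ≤ dist (y i) (y j) := by
      intro i j hij
      rcases lt_or_gt_of_ne hij with h | h
      · exact hno i j h
      · rw [dist_comm]; exact hno j i h
    have hinj : Function.Injective y := by
      intro i j hij
      by_contra hne
      have h1 := hno' i j hne
      rw [hij, dist_self] at h1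
      have : 0 < r / K' := by positivity
      linarith
    have h1 := hm p r hr0 (hAR p hp _ (hx m (by omega)).1).1.2 (Finset.univ.image y) ?_ ?_
    · rw [Finset.card_image_of_injective _ hinj, Finset.card_univ, Fintype.card_fin] at h1
      omega
    · intro z hz
      obtain ⟨i, -, rfl⟩ := Finset.mem_image.1 hz
      rw [dist_comm, hyr]
    · intro z hz z' hz' hne
      obtain ⟨i, -, rfl⟩ := Finset.mem_image.1 hz
      obtain ⟨j, -, rfl⟩ := Finset.mem_image.1 hz'
      exact hno' i j fun h => hne (by rw [h])
  obtain ⟨hxi, hxip⟩ := hx i i.2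
  obtain ⟨hxj, hxjp⟩ := hx j j.2
  have hKAB := hxK i j hij j.2
  have hBr := hxr j j.2
  have hrA := hAR p hp _ hxi
  have hrB := hAR p hp _ hxj
  have hrD := hAR _ hxj _ hxi
  have hc := hcos (x j) p (x i) (by rw [dist_comm]; exact hrB.2.2) hrD.2.2
  set A' := dist p (x i) with hA'
  set B := dist p (x j) with hB
  set D := dist (x j) (x i) with hD
  have hB0 : 0 < B := hr0.trans_le hBr
  have hAB : B < A' := by nlinarith
  have hA0 : 0 < A' := hB0.trans hAB
  have hrA1 : r / A' ≤ 1 := by rw [div_le_one hA0]; linarith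
  have hrB1 : r / B ≤ 1 := by rw [div_le_one hB0]; linarith
  have m1 := hmono p (x j) (x i) (y j) (r / B) (by positivity) hrB1 (hy1 j) (hy2 j) hrB.2.1
    hrA.2.1
  have m2 := hmono p (x i) (y j) (y i) (r / A') (by positivity) hrA1 (hy1 i) (hy2 i) hrA.2.1
    (by rw [hyr]; linarith [hrA.2.1])
  rw [← hA', ← hB, ← hD, div_mul_cancel₀ _ hB0.ne'] at m1
  rw [← hA', hyr, div_mul_cancel₀ _ hA0.ne', dist_comm (x i) (y j)] at m2
  have hh : dist (y j) (x i) ≤ 2 * A' := by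
    have := dist_triangle_left (y j) (x i) p
    rw [hyr] at this
    linarith
  have he : dist (y i) (y j) ≤ r * τ / 2 := by
    refine hclose.le.trans (le_of_eq ?_)
    rw [hKdef']; field_simp
  have hE := two_sub_mul_le_of_sides hτ hηdef hτ1 hr0 hA0 hB0 hh dist_nonneg he m1 m2
  have hD0 : 0 < D := by
    have := dist_triangle p (x j) (x i)
    rw [← hA', ← hB, ← hD] at this
    linarith
  have hDA : D ≤ A' + B := by
    have := dist_triangle_left (x j) (x i) p
    linarith
  have hxne : x i ≠ x j := fun h => by
    rw [hD, h, dist_self] at hD0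
    exact lt_irrefl _ hD0
  refine ⟨p, hp, x j, hxj, x i, hxi, hxjp.symm, hxne, ?_⟩
  by_contra! hang
  have hcl : -cos δ ≤ cos (cangle κ p (x j) (x i)) := by
    rw [← Real.cos_pi_sub]
    exact Real.cos_le_cos_of_nonneg_of_le_pi (cangle_mem _ _ _).1 (by linarith) hang
  rw [dist_comm (x j) p, ← hB] at hc
  have hcd : cos δ = 1 - 2 * τ := by rw [hτdef]; ring
  rw [hcd] at hcl
  refine false_of_sides hτ hηdef hτ1 hB0 hA0 hD0 hDA ?_ hE hcl ?_
  · calc B * 8 = τ * (K * B) := by rw [← hKτ]; ring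
      _ ≤ τ * A' := mul_le_mul_of_nonneg_left hKAB hτ.le
  · have := (abs_le.1 hc).2
    linarith

end Straight

section Strainers

variable {X : Type*} [MetricSpace X] {κ : ℝ}

lemma cos_cangle_first_variation {η : ℝ} (hη : 0 < η) {c p₀ : X} (h : snK κ (dist p₀ c) ≠ 0) :
    ∀ᶠ ρ in 𝓝[>] (0 : ℝ), ∀ p ∈ ball p₀ ρ, ∀ x ∈ ball p₀ ρ,
      |cos (cangle κ c p x) * dist p x - (dist p c - dist x c)| ≤ η * dist p x := by
  obtain ⟨R, hR, hfv⟩ := cos_cangleK_first_variation κ h hη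
  filter_upwards [Ioo_mem_nhdsGT (half_pos hR)] with ρ hρ p hp x hx
  rw [mem_ball] at hp hx
  have hρR := hρ.2
  rcases eq_or_ne p x with rfl | hne
  · simp
  have ht : 0 < dist p x := dist_pos.2 hne
  have h1 : |dist p c - dist p₀ c| < R := (abs_dist_sub_le p p₀ c).trans_lt (by linarith)
  have h2 : dist p x < R := by
    have := dist_triangle_right p x p₀
    linarith
  have h3 : |dist c x - dist p c| ≤ dist p x := by
    rw [dist_comm c x, dist_comm p x]
    exact abs_dist_sub_le x p c
  have h4 := mul_le_mul_of_nonneg_right (hfv _ _ _ h1 ht h2 h3) ht.le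
  rw [dist_comm x c, cangle]
  rwa [← abs_of_pos ht, ← abs_mul, abs_of_pos ht, sub_mul, div_mul_cancel₀ _ ht.ne'] at h4

lemma continuousAt_cangle {c c' p₀ : X} (h : snK κ (dist p₀ c) ≠ 0)
    (h' : snK κ (dist p₀ c') ≠ 0) : ContinuousAt (fun p => cangle κ c p c') p₀ := by
  have hcont (c : X) : Continuous fun p : X => snK κ (dist p c) :=
    (continuous_snK κ).comp (continuous_id.dist continuous_const)
  have h1 : ContinuousAt (fun p => arccos (1 - 2 *
      (snK κ ((dist c c' + dist p c - dist p c') / 2) *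
        snK κ ((dist c c' - dist p c + dist p c') / 2)) /
      (snK κ (dist p c) * snK κ (dist p c')))) p₀ := by
    refine Real.continuous_arccos.continuousAt.comp (continuousAt_const.sub
      (ContinuousAt.div (Continuous.continuousAt ?_) ((hcont c).mul (hcont c')).continuousAt
        (mul_ne_zero h h')))
    have := continuous_snK κ
    fun_prop
  refine h1.congr ?_
  filter_upwards [(hcont c).continuousAt.eventually_ne h, (hcont c').continuousAt.eventually_ne h']
    with p hp hp'
  rw [cangle, cangleK_eq _ hp hp']

lemma snK_ne_zero_of_half_pi_lt {q p r : X} (h : π / 2 < cangle κ q p r) :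
    snK κ (dist p q) ≠ 0 ∧ snK κ (dist p r) ≠ 0 := by
  constructor <;> intro h0
  · rw [cangle, cangleK_of_snK_eq_zero _ (Or.inl h0)] at h
    exact lt_irrefl _ h
  · rw [cangle, cangleK_of_snK_eq_zero _ (Or.inr h0)] at h
    exact lt_irrefl _ h

lemma IsStrainer.snK_ne_zero {k : ℕ} {a b : Fin k → X} {p : X} {δ : ℝ}
    (h : IsStrainer κ a b p δ) (hδ : δ ≤ 1) (i : Fin k) :
    snK κ (dist p (a i)) ≠ 0 ∧ snK κ (dist p (b i)) ≠ 0 := by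
  refine snK_ne_zero_of_half_pi_lt ((?_ : π / 2 ≤ π - δ).trans_lt (h.1 i))
  linarith [Real.pi_gt_three]

lemma IsStrainer.eventually {k : ℕ} {a b : Fin k → X} {p : X} {δ : ℝ}
    (h : IsStrainer κ a b p δ) (hδ : δ ≤ 1) : ∀ᶠ q in 𝓝 p, IsStrainer κ a b q δ := by
  have hs := h.snK_ne_zero hδ
  have hlt {c c' : X} {t : ℝ} (hc : snK κ (dist p c) ≠ 0) (hc' : snK κ (dist p c') ≠ 0)
      (ht : t < cangle κ c p c') : ∀ᶠ q in 𝓝 p, t < cangle κ c q c' :=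
    (continuousAt_cangle hc hc').eventually_const_lt ht
  refine (eventually_all.2 fun i => hlt (hs i).1 (hs i).2 (h.1 i)).and ?_
  refine eventually_all.2 fun i => eventually_all.2 fun j => ?_
  by_cases hij : i = j
  · exact Eventually.of_forall fun q hne => absurd hij hne
  obtain ⟨h1, h2, h3⟩ := h.2 i j hij
  filter_upwards [hlt (hs i).1 (hs j).1 h1, hlt (hs i).1 (hs j).2 h2, hlt (hs i).2 (hs j).2 h3]
    with q g1 g2 g3 _ using ⟨g1, g2, g3⟩

end Strainers

section LowerBound

variable {X : Type*} [MetricSpace X] {κ : ℝ}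

/-- Moving in an extremal subset along the gradient direction of a strainer, with the
two members of a strainer pair playing the roles of `A` and `B`. -/
lemma IsExtremal.exists_step (hX : IsAlexandrov X κ) {E : Set X} (hE : IsExtremal κ E)
    {k : ℕ} {a b : Fin k → X} {p₀ : X} {δ η ρ : ℝ} (hδ : 0 < δ) (hδ1 : δ ≤ 1) (hη : 0 < η)
    (hηδ : η ≤ δ) (hηcos : η < 1 - cos δ)
    (hcpt : IsCompact (closedBall p₀ ρ))
    (hstr : ∀ p ∈ ball p₀ ρ, IsStrainer κ a b p δ)
    (hfv : ∀ c, (∃ i, c = a i ∨ c = b i) → ∀ p ∈ ball p₀ ρ, ∀ x ∈ ball p₀ ρ,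
      |cos (cangle κ c p x) * dist p x - (dist p c - dist x c)| ≤ η * dist p x)
    {p : X} (hpE : p ∈ E) (hp : dist p p₀ < ρ / 4) {t : ℝ} (ht : 0 < t) (htρ : t < ρ / 4)
    {i : Fin k} {A B : X} (hAB : (A = a i ∧ B = b i) ∨ (A = b i ∧ B = a i)) :
    ∃ x ∈ E, dist p x ≤ 2 * t ∧ dist p A + (1 - 4 * δ) * t ≤ dist x A ∧
      dist p B - (1 + δ) * t ≤ dist x B ∧
      (∀ j, j ≠ i → dist p (a j) - 4 * δ * t ≤ dist x (a j) ∧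
        dist p (b j) - 4 * δ * t ≤ dist x (b j)) ∧
      ∀ j, dist x (a j) + dist x (b j) ≤ dist p (a j) + dist p (b j) + 6 * δ * t := by
  have : CompleteSpace X := hX.1
  have hpi := Real.pi_gt_three
  have hne : ∀ c, (∃ i, c = a i ∨ c = b i) → ∀ p ∈ ball p₀ ρ, c ≠ p := by
    rintro c ⟨j, hc⟩ p hp rfl
    have h1 := (hstr c hp).snK_ne_zero hδ1 j
    rcases hc with hc | hc
    · rw [← hc, dist_self] at h1; exact h1.1 (snK_zero κ)
    · rw [← hc, dist_self] at h1; exact h1.2 (snK_zero κ)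
  have hA : ∃ i, A = a i ∨ A = b i := ⟨i, by tauto⟩
  have hB : ∃ i, B = a i ∨ B = b i := ⟨i, by tauto⟩
  have hBfar : ρ ≤ dist B p₀ := by
    by_contra! h
    exact hne B hB B h rfl
  have htB : t ≤ dist p B := by
    have := dist_triangle_left B p₀ p
    linarith
  have hpB : 0 < dist p B := ht.trans_le htB
  obtain ⟨q, hq1, hq2⟩ := exists_dist_eq_mul hX.2.1 p B (l := t / dist p B) (by positivity)
    ((div_le_one hpB).2 htB)
  rw [div_mul_cancel₀ _ hpB.ne'] at hq1
  rw [sub_mul, one_mul, div_mul_cancel₀ _ hpB.ne'] at hq2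
  have hpball : p ∈ ball p₀ ρ := mem_ball.2 (by linarith)
  have hqp₀ : dist q p₀ < ρ / 2 := by
    have := dist_triangle_left q p₀ p
    linarith
  have hqball : q ∈ ball p₀ ρ := mem_ball.2 (by linarith)
  have hpq : p ≠ q := dist_pos.1 (by rw [hq1]; exact ht)
  have hqp : dist q p = t := by rw [dist_comm, hq1]
  have hsq := hstr q hqball
  have hangle : π - δ < cangle κ p q B := by
    by_contra! h
    have h1 := Real.cos_le_cos_of_nonneg_of_le_pi (cangle_mem p q B).1 (by linarith) h
    rw [Real.cos_pi_sub, cangle_comm] at h1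
    have h2 := (abs_le.1 (hfv B hB q hqball p hpball)).2
    rw [hq2, hqp] at h2
    nlinarith [mul_le_mul_of_nonneg_right h1 ht.le]
  have hcosq (c : X) (hc : ∃ i, c = a i ∨ c = b i) :
      dist p c + (-cos (cangle κ B q c) - 2 * δ) * t ≤ dist q c := by
    have h1 := hX.cos_add_cos hpq (hne B hB q hqball) (hne c hc q hqball)
    have h2 := (abs_le.1 (hfv c hc q hqball p hpball)).2
    rw [hqp, cangle_comm] at h2
    nlinarith [mul_le_mul_of_nonneg_right hηδ ht.le]
  have hcos_small {s : ℝ} (hs : π / 2 - δ < s) (hs' : s ≤ π) : cos s ≤ δ := by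
    calc cos s ≤ cos (π / 2 - δ) :=
          Real.cos_le_cos_of_nonneg_of_le_pi (by linarith) hs' hs.le
      _ = sin δ := Real.cos_pi_div_two_sub δ
      _ ≤ δ := Real.sin_le hδ.le
  have hqA : dist p A + (1 - 3 * δ) * t ≤ dist q A := by
    have h1 : π - δ < cangle κ B q A := by
      rcases hAB with ⟨rfl, rfl⟩ | ⟨rfl, rfl⟩
      · rw [cangle_comm]; exact hsq.1 i
      · exact hsq.1 i
    have h2 := Real.cos_le_cos_of_nonneg_of_le_pi (by linarith) (cangle_mem B q A).2 h1.le
    rw [Real.cos_pi_sub] at h2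
    have h3 : 1 - δ ≤ cos δ := by
      have := Real.one_sub_sq_div_two_le_cos (x := δ)
      nlinarith
    nlinarith [hcosq A hA]
  have hqother (j : Fin k) (hj : j ≠ i) : dist p (a j) - 3 * δ * t ≤ dist q (a j) ∧
      dist p (b j) - 3 * δ * t ≤ dist q (b j) := by
    have ha := hcosq (a j) ⟨j, Or.inl rfl⟩
    have hb := hcosq (b j) ⟨j, Or.inr rfl⟩
    have h1 : cos (cangle κ B q (a j)) ≤ δ := by
      refine hcos_small ?_ (cangle_mem _ _ _).2
      rcases hAB with ⟨-, rfl⟩ | ⟨-, rfl⟩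
      · rw [cangle_comm]; exact (hsq.2 j i hj).2.1
      · exact (hsq.2 i j hj.symm).1
    have h2 : cos (cangle κ B q (b j)) ≤ δ := by
      refine hcos_small ?_ (cangle_mem _ _ _).2
      rcases hAB with ⟨-, rfl⟩ | ⟨-, rfl⟩
      · exact (hsq.2 i j hj.symm).2.2
      · exact (hsq.2 i j hj.symm).2.1
    constructor <;> nlinarith
  obtain ⟨x, hxE, hxq, hxc⟩ : ∃ x ∈ E, dist q x ≤ t ∧
      ∀ c, (∃ i, c = a i ∨ c = b i) → dist q c - δ * t ≤ dist x c := by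
    by_cases hqE : q ∈ E
    · refine ⟨q, hqE, by rw [dist_self]; exact ht.le, fun c _ => ?_⟩
      nlinarith
    obtain ⟨x, ⟨hxE, hxρ⟩, hmin⟩ := (hcpt.inter_left hE.1).exists_isMinOn
      ⟨p, hpE, ball_subset_closedBall hpball⟩
      (continuous_const.dist continuous_id : Continuous fun x => dist q x).continuousOn
    have hxq : dist q x ≤ t := by
      rw [← hqp]; exact hmin ⟨hpE, ball_subset_closedBall hpball⟩
    have hxball : x ∈ ball p₀ ρ := by
      have := dist_triangle_left x p₀ q
      rw [mem_ball]; linarith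
    have hcrit := hE.2 q hqE x hxE (by
      filter_upwards [inter_mem_nhdsWithin E (isOpen_ball.mem_nhds hxball)] with y hy
      exact hmin ⟨hy.1, ball_subset_closedBall hy.2⟩)
    refine ⟨x, hxE, hxq, fun c hc => ?_⟩
    have h1 := hcrit c (hne c hc x hxball)
    have h2 := Real.cos_nonneg_of_mem_Icc (x := cangle κ q x c)
      ⟨by linarith [(cangle_mem (κ := κ) q x c).1], h1⟩
    have h3 := (abs_le.1 (hfv c hc x hxball q hqball)).2
    rw [cangle_comm, dist_comm x q] at h3
    have h4 := mul_nonneg h2 (dist_nonneg (x := q) (y := x))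
    have h5 : η * dist q x ≤ δ * t := by gcongr
    linarith
  have hpx : dist p x ≤ 2 * t := by
    have := dist_triangle p q x
    linarith
  have hxball : x ∈ ball p₀ ρ := by
    have := dist_triangle_left x p₀ q
    rw [mem_ball]; linarith
  refine ⟨x, hxE, hpx, ?_, ?_, fun j hj => ⟨?_, ?_⟩, fun j => ?_⟩
  · linarith [hxc A hA]
  · linarith [hxc B hB]
  · linarith [hxc (a j) ⟨j, Or.inl rfl⟩, (hqother j hj).1]
  · linarith [hxc (b j) ⟨j, Or.inr rfl⟩, (hqother j hj).2]
  · rcases eq_or_ne x p with rfl | hxp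
    · nlinarith [mul_pos hδ ht]
    have hca : ∃ i, a j = a i ∨ a j = b i := ⟨j, Or.inl rfl⟩
    have hcb : ∃ i, b j = a i ∨ b j = b i := ⟨j, Or.inr rfl⟩
    have h1 := hX.cos_add_cos (hne _ hca p hpball) (hne _ hcb p hpball) hxp
    have h2 := (abs_le.1 (hfv _ hca p hpball x hxball)).2
    have h3 := (abs_le.1 (hfv _ hcb p hpball x hxball)).2
    have h4 := (hstr p hpball).1 j
    have h5 : 3 * δ * dist p x ≤ 3 * δ * (2 * t) := by gcongr
    have h6 : η * dist p x ≤ δ * dist p x := by gcongr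
    have h7 : -δ * dist p x ≤ (cos (cangle κ (a j) p x) + cos (cangle κ (b j) p x)) * dist p x :=
      mul_le_mul_of_nonneg_right (by linarith) dist_nonneg
    linarith

/-- An extremal subset containing a strained point of rank `k` has dimension at least `k`. -/
lemma IsExtremal.le_dimH_of_isStrainedPt (hX : IsAlexandrov X κ) {E : Set X}
    (hE : IsExtremal κ E) {k : ℕ} {p₀ : X} {δ r₀ : ℝ} (hδ : 0 < δ) (hδ1 : δ ≤ 1)
    (hkδ : 20 * k * δ ≤ 1) (hr₀ : 0 < r₀) (hcpt : IsCompact (closedBall p₀ r₀)) (hp₀ : p₀ ∈ E)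
    (hstr : IsStrainedPt κ k δ p₀) : (k : ℝ≥0∞) ≤ dimH E := by
  obtain ⟨a, b, hab⟩ := hstr
  have hpi := Real.pi_gt_three
  have hcos : 0 < 1 - cos δ := by
    have := Real.cos_lt_cos_of_nonneg_of_le_pi le_rfl (by linarith) hδ
    rw [cos_zero] at this
    linarith
  obtain ⟨η, hη, hηlt⟩ := exists_between (lt_min hδ hcos)
  obtain ⟨hηδ, hηcos⟩ := lt_min_iff.1 hηlt
  have hs := hab.snK_ne_zero hδ1
  obtain ⟨ρ₁, hρ₁, hball⟩ := Metric.eventually_nhds_iff_ball.1 (hab.eventually hδ1)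
  have hev : ∀ᶠ ρ in 𝓝[>] (0 : ℝ), ∀ i, (∀ p ∈ ball p₀ ρ, ∀ x ∈ ball p₀ ρ,
      |cos (cangle κ (a i) p x) * dist p x - (dist p (a i) - dist x (a i))| ≤ η * dist p x) ∧
      (∀ p ∈ ball p₀ ρ, ∀ x ∈ ball p₀ ρ,
      |cos (cangle κ (b i) p x) * dist p x - (dist p (b i) - dist x (b i))| ≤ η * dist p x) :=
    eventually_all.2 fun i => (cos_cangle_first_variation hη (hs i).1).and
      (cos_cangle_first_variation hη (hs i).2)
  obtain ⟨ρ, hfv, hρ0, hρlt⟩ := (hev.and (Ioo_mem_nhdsGT (lt_min hρ₁ hr₀))).exists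
  obtain ⟨hρρ₁, hρr₀⟩ := lt_min_iff.1 hρlt
  have hcptρ : IsCompact (closedBall p₀ ρ) :=
    hcpt.of_isClosed_subset isClosed_closedBall (closedBall_subset_closedBall hρr₀.le)
  have hstep := fun p hpE hp t ht htρ i A B hAB =>
    hE.exists_step hX hδ hδ1 hη hηδ.le hηcos hcptρ
    (fun p hp => hball p (ball_subset_ball hρρ₁.le hp))
    (by
      rintro c ⟨i, rfl | rfl⟩
      · exact (hfv i).1
      · exact (hfv i).2) (p := p) hpE hp (t := t) ht htρ (i := i) (A := A) (B := B) hAB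
  let f : X → Fin k → ℝ := fun p j => dist p (a j)
  have hmove (p : X) (hpE : p ∈ E) (hp : dist p p₀ < ρ / 4) (i : Fin k) (v : ℝ)
      (hv : f p i ≠ v) (hvt : |f p i - v| < ρ / 4) :
      ∃ x ∈ E, dist p x ≤ 2 * |f p i - v| ∧ |f x i - v| ≤ 10 * δ * |f p i - v| ∧
        ∀ j, j ≠ i → |f x j - f p j| ≤ 10 * δ * |f p i - v| := by
    set t := |f p i - v| with ht
    have ht0 : 0 < t := abs_pos.2 (sub_ne_zero.2 hv)
    have hδt : 0 < δ * t := mul_pos hδ ht0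
    rcases lt_or_gt_of_ne hv with h | h
    · obtain ⟨x, hxE, hpx, hA, hB, hc, hsum⟩ := hstep p hpE hp t ht0 hvt i _ _ (Or.inl ⟨rfl, rfl⟩)
      have hti : t = v - f p i := by rw [ht, abs_of_neg (by linarith)]; ring
      refine ⟨x, hxE, hpx, ?_, fun j hj => ?_⟩
      · have := hsum i
        simp only [f] at hti ⊢
        rw [abs_le]; constructor <;> linarith
      · have := hsum j
        have := hc j hj
        simp only [f]
        rw [abs_le]; constructor <;> linarith
    · obtain ⟨x, hxE, hpx, hA, hB, hc, hsum⟩ := hstep p hpE hp t ht0 hvt i _ _ (Or.inr ⟨rfl, rfl⟩)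
      have hti : t = f p i - v := by rw [ht, abs_of_pos (by linarith)]
      refine ⟨x, hxE, hpx, ?_, fun j hj => ?_⟩
      · have := hsum i
        simp only [f] at hti ⊢
        rw [abs_le]; constructor <;> linarith
      · have := hsum j
        have := hc j hj
        simp only [f]
        rw [abs_le]; constructor <;> linarith
  have hfcont : Continuous f := continuous_pi fun j => continuous_id.dist continuous_const
  have hsurj (v : Fin k → ℝ) (hv : ∑ j, |f p₀ j - v j| < ρ / 64) : v ∈ f '' E := by
    let e : X → ℝ := fun x => ∑ j, |f x j - v j|
    have hcont : Continuous fun x => e x + dist x p₀ / 8 := by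
      have : Continuous e := continuous_finsetSum _ fun j _ =>
        (((continuous_apply j).comp hfcont).sub continuous_const).abs
      fun_prop
    have hp₀ρ : p₀ ∈ E ∩ closedBall p₀ (ρ / 4) := ⟨hp₀, mem_closedBall_self (by positivity)⟩
    have hcptE : IsCompact (E ∩ closedBall p₀ (ρ / 4)) :=
      (hcptρ.of_isClosed_subset isClosed_closedBall
        (closedBall_subset_closedBall (by linarith))).inter_left hE.1
    obtain ⟨x, ⟨hxE, -⟩, hmin⟩ := hcptE.exists_isMinOn ⟨p₀, hp₀ρ⟩ hcont.continuousOn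
    have h1 : e x + dist x p₀ / 8 ≤ e p₀ + dist p₀ p₀ / 8 := hmin hp₀ρ
    have he0 : e p₀ < ρ / 64 := hv
    have hex : 0 ≤ e x := Finset.sum_nonneg fun j _ => abs_nonneg _
    rw [dist_self] at h1
    have hxρ : dist x p₀ < ρ / 8 := by linarith
    have hd := dist_nonneg (x := x) (y := p₀)
    refine ⟨x, hxE, ?_⟩
    by_contra hne
    obtain ⟨i₀, hi₀⟩ := Function.ne_iff.1 hne
    obtain ⟨i, -, hi⟩ := Finset.exists_max_image Finset.univ (fun j => |f x j - v j|)
      ⟨i₀, Finset.mem_univ _⟩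
    have hti : 0 < |f x i - v i| :=
      (abs_pos.2 (sub_ne_zero.2 hi₀)).trans_le (hi i₀ (Finset.mem_univ _))
    have hte : |f x i - v i| ≤ e x :=
      Finset.single_le_sum (f := fun j => |f x j - v j|) (fun j _ => abs_nonneg _)
        (Finset.mem_univ i)
    obtain ⟨y, hyE, hxy, hyi, hyj⟩ := hmove x hxE (by linarith) i (v i)
      (sub_ne_zero.1 (abs_pos.1 hti)) (by linarith)
    set t := |f x i - v i| with ht
    have hey : e y ≤ e x - t / 2 := by
      have : e y ≤ ∑ j, (|f x j - v j| + (10 * δ * t - if j = i then t else 0)) := by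
        refine Finset.sum_le_sum fun j _ => ?_
        split_ifs with hj
        · subst hj; linarith
        · have := abs_sub_le (f y j) (f x j) (v j)
          linarith [hyj j hj]
      rw [Finset.sum_add_distrib, Finset.sum_sub_distrib, Finset.sum_const, Finset.sum_ite_eq',
        if_pos (Finset.mem_univ i), Finset.card_univ, Fintype.card_fin, nsmul_eq_mul] at this
      have h2 : (k : ℝ) * (10 * δ * t) ≤ t / 2 := by nlinarith
      change e y ≤ e x + _ at this
      linarith
    have hyp : dist y p₀ ≤ dist x p₀ + 2 * t := by
      have := dist_triangle_left y p₀ x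
      linarith
    have h3 : e x + dist x p₀ / 8 ≤ e y + dist y p₀ / 8 :=
      hmin ⟨hyE, mem_closedBall.2 (by linarith)⟩
    linarith
  have hnhds : f '' E ∈ 𝓝 (f p₀) := by
    have hc : Continuous fun v : Fin k → ℝ => ∑ j, |f p₀ j - v j| := by fun_prop
    have : ∀ᶠ v in 𝓝 (f p₀), ∑ j, |f p₀ j - v j| < ρ / 64 :=
      hc.continuousAt.eventually_lt_const (by simp only [sub_self, abs_zero, Finset.sum_const_zero]; positivity)
    filter_upwards [this] with v hv using hsurj v hv
  have hlip : LipschitzWith 1 f := LipschitzWith.of_dist_le_mul fun x y => by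
    rw [NNReal.coe_one, one_mul, dist_pi_le_iff dist_nonneg]
    exact fun j => by rw [Real.dist_eq]; exact abs_dist_sub_le x y (a j)
  calc (k : ℝ≥0∞) = dimH (f '' E) := by
        rw [Real.dimH_of_mem_nhds hnhds, Module.finrank_fin_fun]
    _ ≤ dimH E := hlip.dimH_image_le E

end LowerBound

section UpperBound

variable {X : Type*} [MetricSpace X] {κ : ℝ}

/-- A nearly straight triple on which the strainer map is almost constant extends the
strainer by one pair. -/
lemma IsAlexandrov.isStrainedPt_succ (hX : IsAlexandrov X κ) {k : ℕ} {a b : Fin k → X}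
    {p₀ : X} {δ η ρ : ℝ} (hδ : 0 < δ) (hδ1 : δ ≤ 1) (hη : η = δ / 16)
    (hstr : ∀ p ∈ ball p₀ ρ, IsStrainer κ a b p η)
    (hfv : ∀ c, (∃ i, c = a i ∨ c = b i) → ∀ p ∈ ball p₀ ρ, ∀ x ∈ ball p₀ ρ,
      |cos (cangle κ c p x) * dist p x - (dist p c - dist x c)| ≤ η * dist p x)
    {x y z : X} (hx : x ∈ ball p₀ ρ) (hy : y ∈ ball p₀ ρ) (hz : z ∈ ball p₀ ρ)
    (hxy : x ≠ y) (hzy : z ≠ y) (hang : π - δ < cangle κ x y z)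
    (hfx : ∀ i, |dist x (a i) - dist y (a i)| ≤ η * dist x y)
    (hfz : ∀ i, |dist z (a i) - dist y (a i)| ≤ η * dist z y) :
    IsStrainedPt κ (k + 1) δ y := by
  have hpi := Real.pi_gt_three
  have hη1 : η ≤ 1 := by linarith
  have hne : ∀ c, (∃ i, c = a i ∨ c = b i) → ∀ p ∈ ball p₀ ρ, c ≠ p := by
    rintro c ⟨j, hc⟩ p hp rfl
    have h1 := (hstr c hp).snK_ne_zero hη1 j
    rcases hc with hc | hc
    · rw [← hc, dist_self] at h1; exact h1.1 (snK_zero κ)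
    · rw [← hc, dist_self] at h1; exact h1.2 (snK_zero κ)
  have key (o : X) (ho : o ∈ ball p₀ ρ) (hoy : o ≠ y)
      (hfo : ∀ i, |dist o (a i) - dist y (a i)| ≤ η * dist o y) (i : Fin k) :
      π / 2 - δ < cangle κ (a i) y o ∧ π / 2 - δ < cangle κ (b i) y o := by
    have hlt (c : X) (h : cos (cangle κ c y o) ≤ 5 * η) : π / 2 - δ < cangle κ c y o := by
      by_contra! hle
      have h1 := Real.cos_le_cos_of_nonneg_of_le_pi (cangle_mem (κ := κ) c y o).1
        (by linarith) hle
      rw [Real.cos_pi_div_two_sub] at h1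
      have h2 := Real.sin_gt_sub_cube hδ
      have h3 : δ ^ 3 ≤ δ := pow_le_of_le_one hδ.le hδ1 (by norm_num)
      linarith
    have hd : 0 < dist o y := dist_pos.2 hoy
    have hca : ∃ j, a i = a j ∨ a i = b j := ⟨i, Or.inl rfl⟩
    have hcb : ∃ j, b i = a j ∨ b i = b j := ⟨i, Or.inr rfl⟩
    have h0 := abs_le.1 (hfo i)
    have ha := (abs_le.1 (hfv _ hca y hy o ho)).2
    have hb := (abs_le.1 (hfv _ hcb y hy o ho)).2
    have ha' := (abs_le.1 (hfv _ hca o ho y hy)).2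
    have hb' := (abs_le.1 (hfv _ hcb o ho y hy)).2
    rw [dist_comm y o] at ha hb
    have h1 := hX.cos_add_cos (hne _ hca o ho) (hne _ hcb o ho) hoy.symm
    have h2 := (hstr o ho).1 i
    have h3 : -η * dist o y ≤
        (cos (cangle κ (a i) o y) + cos (cangle κ (b i) o y)) * dist o y :=
      mul_le_mul_of_nonneg_right (by linarith) hd.le
    refine ⟨hlt _ (le_of_mul_le_mul_right ?_ hd), hlt _ (le_of_mul_le_mul_right ?_ hd)⟩
    · nlinarith
    · linarith
  have hs := hstr y hy
  refine ⟨Fin.cons x a, Fin.cons z b, fun i => ?_, fun i j hij => ?_⟩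
  · cases i using Fin.cases with
    | zero => simpa using hang
    | succ i => simpa using (by linarith : π - δ ≤ π - η).trans_lt (hs.1 i)
  · have hηδ : π / 2 - δ ≤ π / 2 - η := by linarith
    cases i using Fin.cases with
    | zero =>
      cases j using Fin.cases with
      | zero => exact absurd rfl hij
      | succ j =>
        simp only [Fin.cons_zero, Fin.cons_succ]
        rw [cangle_comm κ x, cangle_comm κ x, cangle_comm κ z]
        exact ⟨(key x hx hxy hfx j).1, (key x hx hxy hfx j).2, (key z hz hzy hfz j).2⟩
    | succ i =>
      cases j using Fin.cases with
      | zero =>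
        simp only [Fin.cons_zero, Fin.cons_succ]
        exact ⟨(key x hx hxy hfx i).1, (key z hz hzy hfz i).1, (key z hz hzy hfz i).2⟩
      | succ j =>
        simp only [Fin.cons_succ]
        obtain ⟨h1, h2, h3⟩ := hs.2 i j fun h => hij (by rw [h])
        exact ⟨hηδ.trans_lt h1, hηδ.trans_lt h2, hηδ.trans_lt h3⟩

/-- If every nearly straight triple in `T` is distinguished by the `1`-Lipschitz map `f`, then
separated subsets of `T` at scale `q` have at most `O (q ^ (-k))` points. -/
lemma card_le_of_forall_card_le {k : ℕ} {T : Set X} {f : X → Fin k → ℝ} {η R q r : ℝ} {M m : ℕ}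
    (hf : ∀ x y i, |f x i - f y i| ≤ dist x y) (hη : 0 < η) (hq : 0 < q) (hr : 0 < r)
    (hm : 1 / (η * q) ≤ m) (hrR : 2 * r < R)
    (hM : ∀ A : Finset X, (A : Set X) ⊆ T → (∀ x ∈ A, ∀ y ∈ A, dist x y < R) →
      (∀ x ∈ A, ∀ y ∈ A, ∀ i, |f x i - f y i| ≤ η * dist x y) → A.card ≤ M)
    {x₀ : X} (A : Finset X) (hAT : (A : Set X) ⊆ T) (hA : ∀ x ∈ A, dist x x₀ ≤ r)
    (hsep : ∀ x ∈ A, ∀ y ∈ A, x ≠ y → q * r ≤ dist x y) :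
    A.card ≤ (2 * m + 1) ^ k * M := by
  classical
  by_contra! hcard
  have hpos : 0 < η * (q * r) := by positivity
  let g : X → Fin k → ℤ := fun x i => ⌊(f x i - f x₀ i) / (η * (q * r))⌋
  let G : Finset (Fin k → ℤ) := Fintype.piFinset fun _ => Finset.Icc (-(m : ℤ)) m
  have hG : G.card = (2 * m + 1) ^ k := by
    simp only [G, Fintype.card_piFinset, Int.card_Icc, Finset.prod_const, Finset.card_univ,
      Fintype.card_fin]
    congr 1
    omega
  have hgG : ∀ x ∈ A, g x ∈ G := by
    intro x hx
    refine Fintype.mem_piFinset.2 fun i => ?_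
    have h1 : |(f x i - f x₀ i) / (η * (q * r))| ≤ m := by
      rw [abs_div, abs_of_pos hpos, div_le_iff₀ hpos]
      refine ((hf x x₀ i).trans (hA x hx)).trans ?_
      rw [div_le_iff₀ (by positivity)] at hm
      nlinarith
    obtain ⟨h2, h3⟩ := abs_le.1 h1
    rw [Finset.mem_Icc]
    refine ⟨Int.le_floor.2 (by push_cast; exact h2), ?_⟩
    exact_mod_cast (Int.floor_le _).trans h3
  obtain ⟨c, -, hc⟩ := Finset.exists_lt_card_fiber_of_mul_lt_card_of_maps_to hgG
    (n := M) (by rwa [hG])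
  refine absurd (hM _ (fun x hx => hAT (Finset.mem_filter.1 (Finset.mem_coe.1 hx)).1) ?_ ?_)
    hc.not_ge
  · intro x hx y hy
    have h1 := hA x (Finset.mem_filter.1 hx).1
    have h2 := hA y (Finset.mem_filter.1 hy).1
    have := dist_triangle_right x y x₀
    linarith
  · intro x hx y hy i
    obtain ⟨hxA, hxc⟩ := Finset.mem_filter.1 hx
    obtain ⟨hyA, hyc⟩ := Finset.mem_filter.1 hy
    rcases eq_or_ne x y with rfl | hne
    · simp
    have h1 : |(f x i - f x₀ i) / (η * (q * r)) - (f y i - f x₀ i) / (η * (q * r))| < 1 :=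
      Int.abs_sub_lt_one_of_floor_eq_floor (congrFun (hxc.trans hyc.symm) i)
    rw [← sub_div, abs_div, abs_of_pos hpos, div_lt_one hpos, sub_sub_sub_cancel_right] at h1
    exact h1.le.trans (mul_le_mul_of_nonneg_left (hsep x hxA y hyA hne) hη.le)

lemma exists_scale_of_card_bound (k M : ℕ) {η : ℝ} (hη : 0 < η) (hη1 : η ≤ 1) {θ : ℝ≥0}
    (hθ : 0 < θ) : ∃ q : ℝ, 0 < q ∧ q < 1 ∧ ∃ m : ℕ, 1 / (η * q) ≤ m ∧
      (((2 * m + 1) ^ k * M : ℕ) : ℝ) * q ^ (((k + θ : ℝ≥0)) : ℝ) ≤ 1 := by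
  have hθ' : (0 : ℝ) < θ := hθ
  obtain ⟨J, hJ, hJ1⟩ := (((tendsto_rpow_atTop hθ').eventually_ge_atTop
    ((5 / η) ^ k * M)).and (eventually_gt_atTop 1)).exists
  have hJ0 : 0 < J := by linarith
  refine ⟨J⁻¹, by positivity, inv_lt_one_of_one_lt₀ hJ1, ⌈J / η⌉₊, ?_, ?_⟩
  · have : 1 / (η * J⁻¹) = J / η := by field_simp
    rw [this]
    exact Nat.le_ceil _
  · have h1 : (⌈J / η⌉₊ : ℝ) ≤ J / η + 1 := (Nat.ceil_lt_add_one (by positivity)).le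
    have h2 : 1 ≤ J / η := by rw [le_div_iff₀ hη]; linarith
    have h3 : 2 * (⌈J / η⌉₊ : ℝ) + 1 ≤ 5 / η * J := by
      have : 5 / η * J = 5 * (J / η) := by ring
      linarith
    have h4 : (2 * (⌈J / η⌉₊ : ℝ) + 1) ^ k ≤ (5 / η * J) ^ k := by gcongr
    have h5 : J⁻¹ ^ (((k + θ : ℝ≥0)) : ℝ) = (J ^ k * J ^ (θ : ℝ))⁻¹ := by
      rw [Real.inv_rpow hJ0.le, NNReal.coe_add, NNReal.coe_natCast, Real.rpow_add hJ0,
        Real.rpow_natCast]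
    have h6 : 0 < J ^ (θ : ℝ) := Real.rpow_pos_of_pos hJ0 _
    rw [h5, ← div_eq_mul_inv, div_le_one (by positivity)]
    push_cast
    calc (2 * (⌈J / η⌉₊ : ℝ) + 1) ^ k * M ≤ (5 / η * J) ^ k * M := by gcongr
      _ = J ^ k * ((5 / η) ^ k * M) := by rw [mul_pow]; ring
      _ ≤ _ := by gcongr

/-- The points which are `(k,δ/16)`-strained but not `(k+1,δ)`-strained form a set of
dimension at most `k`, locally. -/
lemma IsAlexandrov.exists_dimH_le (hX : IsAlexandrov X κ) {n : ℕ}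
    (hdim : dimH (univ : Set X) = n) {k : ℕ} {δ : ℝ} (hδ : 0 < δ) (hδ1 : δ ≤ 1) {p₀ : X}
    (hp₀ : IsStrainedPt κ k (δ / 16) p₀) (hp₀' : ¬ IsStrainedPt κ (k + 1) δ p₀) {θ : ℝ≥0}
    (hθ : 0 < θ) :
    ∃ ρ > 0, dimH ({p | ¬ IsStrainedPt κ (k + 1) δ p} ∩ ball p₀ ρ) ≤ (k + θ : ℝ≥0) := by
  obtain ⟨a, b, hab⟩ := hp₀
  set η : ℝ := δ / 16 with hη
  have hη0 : 0 < η := by positivity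
  have hη1 : η ≤ 1 := by linarith
  have hs := hab.snK_ne_zero hη1
  obtain ⟨ρ₁, hρ₁, hball⟩ := Metric.eventually_nhds_iff_ball.1 (hab.eventually hη1)
  have hev : ∀ᶠ ρ in 𝓝[>] (0 : ℝ), ∀ i, (∀ p ∈ ball p₀ ρ, ∀ x ∈ ball p₀ ρ,
      |cos (cangle κ (a i) p x) * dist p x - (dist p (a i) - dist x (a i))| ≤ η * dist p x) ∧
      (∀ p ∈ ball p₀ ρ, ∀ x ∈ ball p₀ ρ,
      |cos (cangle κ (b i) p x) * dist p x - (dist p (b i) - dist x (b i))| ≤ η * dist p x) :=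
    eventually_all.2 fun i => (cos_cangle_first_variation hη0 (hs i).1).and
      (cos_cangle_first_variation hη0 (hs i).2)
  obtain ⟨ρ, hfv, hρ0, hρρ₁⟩ := (hev.and (Ioo_mem_nhdsGT hρ₁)).exists
  obtain ⟨M, R, hR, hM⟩ := hX.exists_nearly_straight hdim hδ hδ1
  obtain ⟨q, hq0, hq1, m, hm, hP⟩ := exists_scale_of_card_bound k M hη0 hη1 hθ
  set T : Set X := {p | ¬ IsStrainedPt κ (k + 1) δ p} ∩ ball p₀ ρ with hT
  have hcov : ∀ x ∈ T, ∀ r, 0 < r → r ≤ R / 4 → ∃ F : Finset X, (F : Set X) ⊆ T ∧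
      F.card ≤ (2 * m + 1) ^ k * M ∧ ∀ y ∈ T, dist y x ≤ r → ∃ c ∈ F, dist y c ≤ q * r := by
    intro x hx r hr hrR
    obtain ⟨F, hF1, hF2, hF3⟩ := exists_cover_of_card_le (S := T ∩ closedBall x r)
      (s := q * r) (by positivity) (N := (2 * m + 1) ^ k * M) fun A hA hsep =>
        card_le_of_forall_card_le (f := fun x i => dist x (a i)) (R := R) (x₀ := x)
          (fun x y i => abs_dist_sub_le x y (a i)) hη0 hq0 hr hm (by linarith)
          (fun B hBT hBR hBf => by
            by_contra! hcard
            obtain ⟨x, hx, y, hy, z, hz, hxy, hzy, hang⟩ := hM B hcard hBR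
            refine (hBT hy).1 (hX.isStrainedPt_succ hδ hδ1 hη
              (fun p hp => hball p (ball_subset_ball hρρ₁.le hp)) ?_
              (hBT hx).2 (hBT hy).2 (hBT hz).2 hxy hzy hang (hBf x hx y hy) (hBf z hz y hy))
            rintro c ⟨i, rfl | rfl⟩
            · exact (hfv i).1
            · exact (hfv i).2)
          A (fun z hz => (hA hz).1) (fun z hz => (hA hz).2) hsep
    exact ⟨F, fun z hz => (hF1 hz).1, hF2, fun y hy hyx => hF3 y ⟨hy, hyx⟩⟩
  refine ⟨min ρ (R / 4), lt_min hρ0 (by positivity), ?_⟩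
  refine (dimH_mono ?_).trans (dimH_le_of_cover (by positivity) hq0 hq1 hP hcov
    (x := p₀) ⟨hp₀', mem_ball_self hρ0⟩)
  rintro x ⟨hx, hxb⟩
  obtain ⟨h1, h2⟩ := lt_min_iff.1 (mem_ball.1 hxb)
  exact ⟨⟨hx, h1⟩, h2.le⟩

lemma isStrainedPt_zero (δ : ℝ) (p : X) : IsStrainedPt κ 0 δ p :=
  ⟨Fin.elim0, Fin.elim0, fun i => i.elim0, fun i => i.elim0⟩

/-- The set of points that are not `(k+1,δ)`-strained has dimension at most `k`. -/
lemma IsAlexandrov.dimH_setOf_not_isStrainedPt_le (hX : IsAlexandrov X κ) {n : ℕ}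
    (hdim : dimH (univ : Set X) = n) (k : ℕ) {δ : ℝ} (hδ : 0 < δ) (hδ1 : δ ≤ 1) :
    dimH {p : X | ¬ IsStrainedPt κ (k + 1) δ p} ≤ k := by
  have : SecondCountableTopology X :=
    secondCountableTopology_of_dimH_lt_top (by rw [hdim]; exact ENNReal.natCast_lt_top n)
  have hstep : ∀ (k : ℕ) (δ : ℝ), 0 < δ → δ ≤ 1 →
      dimH {p : X | ¬ IsStrainedPt κ k (δ / 16) p} ≤ k →
      dimH {p : X | ¬ IsStrainedPt κ (k + 1) δ p} ≤ k := by
    intro k δ hδ hδ1 hk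
    have hlow : dimH {p : X | ¬ IsStrainedPt κ (k + 1) δ p ∧ IsStrainedPt κ k (δ / 16) p} ≤ k := by
      refine ENNReal.le_of_forall_pos_le_add fun θ hθ _ => ?_
      by_contra! hlt
      obtain ⟨p₀, hp₀, hnhds⟩ := exists_mem_nhdsWithin_lt_dimH_of_lt_dimH hlt
      obtain ⟨ρ, hρ, hle⟩ := hX.exists_dimH_le hdim hδ hδ1 hp₀.2 hp₀.1 hθ
      have h1 := hnhds _ (inter_mem_nhdsWithin _ (ball_mem_nhds p₀ hρ))
      refine absurd (h1.trans_le (dimH_mono (inter_subset_inter_left _ fun p hp => hp.1)))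
        (not_lt.2 (hle.trans_eq ?_))
      push_cast
      rfl
    have hsub : {p : X | ¬ IsStrainedPt κ (k + 1) δ p} ⊆
        {p | ¬ IsStrainedPt κ k (δ / 16) p} ∪
          {p | ¬ IsStrainedPt κ (k + 1) δ p ∧ IsStrainedPt κ k (δ / 16) p} := fun p hp => by
      by_cases h : IsStrainedPt κ k (δ / 16) p
      · exact Or.inr ⟨hp, h⟩
      · exact Or.inl h
    exact (dimH_mono hsub).trans (by rw [dimH_union]; exact max_le hk hlow)
  induction k generalizing δ with
  | zero =>
    refine hstep 0 δ hδ hδ1 ?_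
    have : {p : X | ¬ IsStrainedPt κ 0 (δ / 16) p} = ∅ :=
      eq_empty_of_forall_notMem fun p hp =>
        hp (isStrainedPt_zero _ p)
    simp [this]
  | succ k ih =>
    refine hstep (k + 1) δ hδ hδ1 ((ih (by positivity) (by linarith)).trans ?_)
    exact_mod_cast k.le_succ

end UpperBound

section StrainerNumber

variable {X : Type*} [MetricSpace X] {κ : ℝ}

/-- Small closed balls in a finite-dimensional Alexandrov space are compact. -/
lemma IsAlexandrov.exists_isCompact_closedBall (hX : IsAlexandrov X κ) {n : ℕ}
    (hdim : dimH (univ : Set X) = n) :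
    ∃ r > 0, ∀ p : X, IsCompact (closedBall p r) := by
  have : CompleteSpace X := hX.1
  obtain ⟨N, R, hR, hN⟩ := hX.card_le_of_separated hdim (K := 2) (by norm_num)
  refine ⟨R / 2, half_pos hR, fun p => isCompact_closedBall_of_cover (half_pos hR)
    (q := 1 / 2) (by norm_num) (by norm_num) (P := N) (fun x r hr hrR => ?_) p⟩
  obtain ⟨F, -, hF, hcov⟩ := exists_cover_of_card_le (S := closedBall x r) (s := 1 / 2 * r)
    (by positivity) (N := N) fun A hA hsep =>
      hN x r hr (by linarith) A (fun y hy => hA hy) fun y hy z hz hyz => by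
        have := hsep y hy z hz hyz
        linarith
  exact ⟨F, hF, fun y hy => hcov y hy⟩

lemma IsStrainedPt.mono {k l : ℕ} (hkl : k ≤ l) {δ : ℝ} {p : X} (hp : IsStrainedPt κ l δ p) :
    IsStrainedPt κ k δ p := by
  obtain ⟨a, b, h1, h2⟩ := hp
  exact ⟨a ∘ Fin.castLE hkl, b ∘ Fin.castLE hkl, fun i => h1 _,
    fun i j hij => h2 _ _ fun h => hij (Fin.castLE_injective hkl h)⟩

/-- The Hausdorff dimension of an extremal subset is its strainer number. -/
lemma IsAlexandrov.exists_dimH_eq_strainerNumber (hX : IsAlexandrov X κ) {n : ℕ}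
    (hdim : dimH (univ : Set X) = n) {E : Set X} (hE : IsExtremal κ E) {δ : ℝ} (hδ : 0 < δ)
    (hδn : δ < 1 / (20 * (n + 1))) :
    ∃ m : ℕ, dimH E = m ∧
      dimH E = sSup {d : ℝ≥0∞ | ∃ k : ℕ, d = k ∧ ∃ p ∈ E, IsStrainedPt κ k δ p} := by
  classical
  rw [lt_div_iff₀ (by positivity)] at hδn
  have hn0 : (0 : ℝ) ≤ n := n.cast_nonneg
  have hδ1 : δ ≤ 1 := by nlinarith
  obtain rfl | ⟨p₀, hp₀⟩ := E.eq_empty_or_nonempty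
  · exact ⟨0, by simp, by simp⟩
  obtain ⟨r₀, hr₀, hcpt⟩ := hX.exists_isCompact_closedBall hdim
  have hlow : ∀ k ≤ n + 1, ∀ p ∈ E, IsStrainedPt κ k δ p → (k : ℝ≥0∞) ≤ dimH E := by
    intro k hk p hp hstr
    have hk' : (k : ℝ) ≤ n + 1 := by exact_mod_cast hk
    exact hE.le_dimH_of_isStrainedPt hX hδ hδ1 (by nlinarith) hr₀ (hcpt p) hp hstr
  have hbound : ∀ k, ∀ p ∈ E, IsStrainedPt κ k δ p → k ≤ n := by
    intro k p hp hstr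
    by_contra! hk
    have h1 := (hlow (n + 1) le_rfl p hp (hstr.mono hk)).trans (dimH_mono (subset_univ E))
    rw [hdim] at h1
    have : n + 1 ≤ n := by exact_mod_cast h1
    omega
  set P : ℕ → Prop := fun k => ∃ p ∈ E, IsStrainedPt κ k δ p with hP
  have hP0 : P 0 := ⟨p₀, hp₀, isStrainedPt_zero δ p₀⟩
  obtain ⟨p, hp, hstr⟩ : P (Nat.findGreatest P n) := Nat.findGreatest_spec n.zero_le hP0
  set m := Nat.findGreatest P n with hm
  have hmax : ∀ k, P k → k ≤ m := fun k ⟨q, hq, hqk⟩ =>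
    Nat.le_findGreatest (hbound k q hq hqk) ⟨q, hq, hqk⟩
  have hdimE : dimH E = m := by
    refine le_antisymm ((dimH_mono fun q hq hqs => ?_).trans
      (hX.dimH_setOf_not_isStrainedPt_le hdim m hδ hδ1))
      (hlow m ((hbound m p hp hstr).trans n.le_succ) p hp hstr)
    exact (hmax (m + 1) ⟨q, hq, hqs⟩).not_gt m.lt_succ_self
  refine ⟨m, hdimE, ?_⟩
  rw [hdimE]
  refine le_antisymm (le_sSup ⟨m, rfl, p, hp, hstr⟩) (sSup_le ?_)
  rintro _ ⟨k, rfl, hk⟩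
  exact_mod_cast hmax k hk

end StrainerNumber

end Auxiliary

/-- for all sufficiently small `δ > 0`, the Hausdorff dimension of an
extremal subset equals its `δ`-strainer number; in particular it is an integer. -/
theorem stmt5 {X : Type*} [MetricSpace X] (κ : ℝ) (hX : IsAlexandrov X κ)
    (n : ℕ) (hdim : dimH (Set.univ : Set X) = n)
    (E : Set X) (hE : IsExtremal κ E) :
    ∃ δ₀ > (0:ℝ),
      (∀ δ : ℝ, 0 < δ → δ < δ₀ →
        dimH E = sSup {d : ℝ≥0∞ | ∃ k : ℕ, d = k ∧ ∃ p ∈ E, IsStrainedPt κ k δ p}) ∧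
      ∃ m : ℕ, dimH E = m := by
  refine ⟨1 / (20 * (n + 1)), by positivity, ?_⟩
  have key : ∀ δ : ℝ, 0 < δ → δ < 1 / (20 * (n + 1)) → ∃ m : ℕ, dimH E = m ∧
      dimH E = sSup {d : ℝ≥0∞ | ∃ k : ℕ, d = k ∧ ∃ p ∈ E, IsStrainedPt κ k δ p} :=
    fun δ hδ hδ₀ => hX.exists_dimH_eq_strainerNumber hdim hE hδ hδ₀
  refine ⟨fun δ hδ hδ₀ => (key δ hδ hδ₀).choose_spec.2, ?_⟩
  have hpos : (0 : ℝ) < 1 / (20 * (n + 1)) := by positivity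
  obtain ⟨m, hm, -⟩ := key _ (half_pos hpos) (half_lt_self hpos)
  exact ⟨m, hm⟩
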